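/- Weighted coercivity of the regularized linearized Landau operator: Let κ ∈ [0,1] and ϑ < 0. Then there exist δ > 0 and C > 0 such that for every Schwartz function g : ℝ³ → ℝ, ∫_{ℝ³} ⟨v⟩^{−2ϑ} (L^κ g)(v) g(v) dv ≥ δ² |g|²_{σ_κ,ϑ} − C |g|²_{σ_κ,ϑ+1/2}, where |g|²_{σ_κ,ℓ} = |g|²_{σ,ℓ} + κ |g|²_{σ_R,−ℓ}. -/

import Mathlib

noncomputable section

open MeasureTheory Real

/-- Velocity space `ℝ³`. -/
abbrev V3 : Type := EuclideanSpace ℝ (Fin 3)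

/-- The standard Maxwellian `μ₀(v) = (2π)^{-3/2} exp(−|v|²/2)`. -/
def mu0 (v : V3) : ℝ := (2 * π) ^ (-(3 : ℝ) / 2) * Real.exp (-‖v‖ ^ 2 / 2)

/-- The Japanese bracket `⟨v⟩ = (1+|v|²)^{1/2}`. -/
def jap (v : V3) : ℝ := Real.sqrt (1 + ‖v‖ ^ 2)

/-- The Coulomb Landau kernel `φ^{ij}(z) = (δ^{ij} − z_iz_j/|z|²)|z|⁻¹`. -/
def kerC (z : V3) (i j : Fin 3) : ℝ :=
  ((if i = j then (1 : ℝ) else 0) - z i * z j / ‖z‖ ^ 2) * ‖z‖⁻¹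

/-- The hard Landau kernel `φ_R^{ij}(z) = (δ^{ij} − z_iz_j/|z|²)|z|`. -/
def kerR (z : V3) (i j : Fin 3) : ℝ :=
  ((if i = j then (1 : ℝ) else 0) - z i * z j / ‖z‖ ^ 2) * ‖z‖

/-- Partial derivative `∂_i` in `v`. -/
def pd (i : Fin 3) (g : V3 → ℝ) (v : V3) : ℝ :=
  fderiv ℝ g v (EuclideanSpace.single i 1)

/-- The Landau-type collision operator with kernel `ker`. -/
def landauQ (ker : V3 → Fin 3 → Fin 3 → ℝ) (F₁ F₂ : V3 → ℝ) (v : V3) : ℝ :=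
  ∑ i, pd i (fun w => ∫ u : V3, ∑ j,
    ker (w - u) i j * (F₁ u * pd j F₂ w - F₂ w * pd j F₁ u)) v

/-- `√μ₀`. -/
def sqmu (v : V3) : ℝ := Real.sqrt (mu0 v)

/-- The linearized Landau operator `L g = −μ₀^{-1/2}(Q(μ₀, √μ₀ g) + Q(√μ₀ g, μ₀))`. -/
def Lc (g : V3 → ℝ) (v : V3) : ℝ :=
  -(sqmu v)⁻¹ * (landauQ kerC mu0 (fun w => sqmu w * g w) v
    + landauQ kerC (fun w => sqmu w * g w) mu0 v)

/-- The hard linearized Landau operator `L^R`. -/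
def LR (g : V3 → ℝ) (v : V3) : ℝ :=
  -(sqmu v)⁻¹ * (landauQ kerR mu0 (fun w => sqmu w * g w) v
    + landauQ kerR (fun w => sqmu w * g w) mu0 v)

/-- The regularized linearized Landau operator `L^κ = L + κ L^R`
(coming from `Q_κ = Q + κ Q_R`). -/
def Lkap (κ : ℝ) (g : V3 → ℝ) (v : V3) : ℝ := Lc g v + κ * LR g v

/-- `σ^{ij} = φ^{ij} ∗ μ₀`. -/
def sigC (v : V3) (i j : Fin 3) : ℝ := ∫ u : V3, kerC (v - u) i j * mu0 u

/-- `σ_R^{ij} = φ_R^{ij} ∗ μ₀`. -/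
def sigR (v : V3) (i j : Fin 3) : ℝ := ∫ u : V3, kerR (v - u) i j * mu0 u

/-- The dissipation norm `|g|²_{σ,ℓ} = ∫ ⟨v⟩^{-2ℓ} σ^{ij}(∂_ig∂_jg + v_iv_jg²)`. -/
def sNormSq (ℓ : ℝ) (g : V3 → ℝ) : ℝ :=
  ∫ v : V3, jap v ^ (-(2 * ℓ)) *
    ∑ i, ∑ j, sigC v i j * (pd i g v * pd j g v + v i * v j * (g v) ^ 2)

/-- The dissipation norm `|g|²_{σ_R,ℓ} = ∫ ⟨v⟩^{2ℓ} σ_R^{ij}(∂_ig∂_jg + v_iv_jg²)`. -/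
def sRNormSq (ℓ : ℝ) (g : V3 → ℝ) : ℝ :=
  ∫ v : V3, jap v ^ (2 * ℓ) *
    ∑ i, ∑ j, sigR v i j * (pd i g v * pd j g v + v i * v j * (g v) ^ 2)

/-- The regularized dissipation norm `|g|²_{σ_κ,ℓ} = |g|²_{σ,ℓ} + κ|g|²_{σ_R,−ℓ}`. -/
def sKapNormSq (κ ℓ : ℝ) (g : V3 → ℝ) : ℝ := sNormSq ℓ g + κ * sRNormSq (-ℓ) g

/-- measurable of polynomial growth -/
def Pg (f : V3 → ℝ) : Prop := Measurable f ∧ ∃ (C : ℝ) (N : ℕ), ∀ v, |f v| ≤ C * (1 + ‖v‖) ^ N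

/-- measurable of rapid decay -/
def Rd (f : V3 → ℝ) : Prop :=
  Measurable f ∧ ∀ N : ℕ, ∃ C : ℝ, ∀ v, |f v| * (1 + ‖v‖) ^ N ≤ C

theorem one_le_jb (v : V3) : (1:ℝ) ≤ 1 + ‖v‖ := by linarith [norm_nonneg v]

theorem Pg.exists_nonneg {f : V3 → ℝ} (h : Pg f) :
    ∃ (C : ℝ) (N : ℕ), 0 ≤ C ∧ ∀ v, |f v| ≤ C * (1 + ‖v‖) ^ N := by
  obtain ⟨C, N, hC⟩ := h.2
  refine ⟨C, N, ?_, hC⟩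
  have := hC 0
  simp at this
  exact (abs_nonneg _).trans this

theorem Pg.add {f g : V3 → ℝ} (hf : Pg f) (hg : Pg g) : Pg (fun v => f v + g v) := by
  obtain ⟨C, N, hC0, hC⟩ := hf.exists_nonneg
  obtain ⟨D, M, hD0, hD⟩ := hg.exists_nonneg
  refine ⟨hf.1.add hg.1, C + D, N + M, fun v => ?_⟩
  have h1 := one_le_jb v
  have e1 : (1 + ‖v‖) ^ N ≤ (1 + ‖v‖) ^ (N + M) := pow_le_pow_right₀ h1 (by omega)
  have e2 : (1 + ‖v‖) ^ M ≤ (1 + ‖v‖) ^ (N + M) := pow_le_pow_right₀ h1 (by omega)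
  calc |f v + g v| ≤ |f v| + |g v| := abs_add_le _ _
    _ ≤ C * (1 + ‖v‖) ^ N + D * (1 + ‖v‖) ^ M := add_le_add (hC v) (hD v)
    _ ≤ C * (1 + ‖v‖) ^ (N + M) + D * (1 + ‖v‖) ^ (N + M) := by gcongr
    _ = _ := by ring

theorem Pg.mul {f g : V3 → ℝ} (hf : Pg f) (hg : Pg g) : Pg (fun v => f v * g v) := by
  obtain ⟨C, N, hC0, hC⟩ := hf.exists_nonneg
  obtain ⟨D, M, hD0, hD⟩ := hg.exists_nonneg
  refine ⟨hf.1.mul hg.1, C * D, N + M, fun v => ?_⟩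
  calc |f v * g v| = |f v| * |g v| := abs_mul _ _
    _ ≤ (C * (1 + ‖v‖) ^ N) * (D * (1 + ‖v‖) ^ M) :=
        mul_le_mul (hC v) (hD v) (abs_nonneg _) ((abs_nonneg _).trans (hC v))
    _ = _ := by rw [pow_add]; ring

theorem Pg.mono {f g : V3 → ℝ} (hf : Measurable f) (hg : Pg g) (h : ∀ v, |f v| ≤ |g v|) : Pg f := by
  obtain ⟨C, N, hC⟩ := hg.2
  exact ⟨hf, C, N, fun v => (h v).trans (hC v)⟩

theorem Pg.const (c : ℝ) : Pg (fun _ => c) := ⟨measurable_const, |c|, 0, fun v => by simp⟩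

theorem Pg.neg {f : V3 → ℝ} (hf : Pg f) : Pg (fun v => - f v) :=
  Pg.mono hf.1.neg hf (fun v => by simp)

theorem Pg.sub {f g : V3 → ℝ} (hf : Pg f) (hg : Pg g) : Pg (fun v => f v - g v) := by
  simpa [sub_eq_add_neg] using hf.add hg.neg

theorem Pg.abs {f : V3 → ℝ} (hf : Pg f) : Pg (fun v => |f v|) :=
  Pg.mono hf.1.abs hf (fun v => by simp)

theorem Pg.pow {f : V3 → ℝ} (hf : Pg f) (n : ℕ) : Pg (fun v => f v ^ n) := by
  induction n with
  | zero => simpa using Pg.const 1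
  | succ n ih => simpa [pow_succ] using ih.mul hf

theorem Pg.sum {ι : Type*} (s : Finset ι) {f : ι → V3 → ℝ} (hf : ∀ i, Pg (f i)) :
    Pg (fun v => ∑ i ∈ s, f i v) := by
  classical
  induction s using Finset.induction_on with
  | empty => simpa using Pg.const 0
  | insert a s ha ih => simpa [Finset.sum_insert ha] using (hf a).add ih

theorem Pg.norm : Pg (fun v => ‖v‖) :=
  ⟨measurable_norm, 1, 1, fun v => by simp⟩

theorem abs_coord_le (v : V3) (i : Fin 3) : |v i| ≤ ‖v‖ := by
  simpa using PiLp.norm_apply_le v i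

theorem measurable_coord (i : Fin 3) : Measurable (fun v : V3 => v i) :=
  ((EuclideanSpace.proj i : V3 →L[ℝ] ℝ).continuous).measurable

theorem Pg.coord (i : Fin 3) : Pg (fun v => v i) :=
  Pg.mono (measurable_coord i) Pg.norm (fun v => by simpa using abs_coord_le v i)

theorem Rd.pg {f : V3 → ℝ} (hf : Rd f) : Pg f := by
  obtain ⟨C, hC⟩ := hf.2 0
  exact ⟨hf.1, C, 0, fun v => by simpa using hC v⟩

theorem Rd.add {f g : V3 → ℝ} (hf : Rd f) (hg : Rd g) : Rd (fun v => f v + g v) := by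
  refine ⟨hf.1.add hg.1, fun N => ?_⟩
  obtain ⟨C, hC⟩ := hf.2 N
  obtain ⟨D, hD⟩ := hg.2 N
  refine ⟨C + D, fun v => ?_⟩
  have : |f v + g v| * (1 + ‖v‖) ^ N ≤ (|f v| + |g v|) * (1 + ‖v‖) ^ N := by
    gcongr; exact abs_add_le _ _
  linarith [hC v, hD v]

theorem Rd.mul_pg {f g : V3 → ℝ} (hf : Rd f) (hg : Pg g) : Rd (fun v => f v * g v) := by
  refine ⟨hf.1.mul hg.1, fun N => ?_⟩
  obtain ⟨D, M, hD0, hD⟩ := hg.exists_nonneg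
  obtain ⟨C, hC⟩ := hf.2 (N + M)
  refine ⟨C * D, fun v => ?_⟩
  calc |f v * g v| * (1 + ‖v‖) ^ N = |f v| * |g v| * (1 + ‖v‖) ^ N := by rw [abs_mul]
    _ ≤ |f v| * (D * (1 + ‖v‖) ^ M) * (1 + ‖v‖) ^ N := by gcongr; exact hD v
    _ = (|f v| * (1 + ‖v‖) ^ (N + M)) * D := by rw [pow_add]; ring
    _ ≤ C * D := by gcongr; exact hC v

theorem Pg.mul_rd {f g : V3 → ℝ} (hf : Pg f) (hg : Rd g) : Rd (fun v => f v * g v) := by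
  simpa [mul_comm] using hg.mul_pg hf

theorem Rd.mono {f g : V3 → ℝ} (hf : Measurable f) (hg : Rd g) (h : ∀ v, |f v| ≤ |g v|) : Rd f := by
  refine ⟨hf, fun N => ?_⟩
  obtain ⟨C, hC⟩ := hg.2 N
  exact ⟨C, fun v => le_trans (mul_le_mul_of_nonneg_right (h v) (by positivity)) (hC v)⟩

theorem Rd.neg {f : V3 → ℝ} (hf : Rd f) : Rd (fun v => - f v) :=
  Rd.mono hf.1.neg hf (fun v => by simp)

theorem Rd.sub {f g : V3 → ℝ} (hf : Rd f) (hg : Rd g) : Rd (fun v => f v - g v) := by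
  simpa [sub_eq_add_neg] using hf.add hg.neg

theorem Rd.abs {f : V3 → ℝ} (hf : Rd f) : Rd (fun v => |f v|) :=
  Rd.mono hf.1.abs hf (fun v => by simp)

theorem Rd.zero : Rd (fun _ => 0) := ⟨measurable_const, fun N => ⟨0, fun v => by simp⟩⟩

theorem Rd.sum {ι : Type*} (s : Finset ι) {f : ι → V3 → ℝ} (hf : ∀ i, Rd (f i)) :
    Rd (fun v => ∑ i ∈ s, f i v) := by
  classical
  induction s using Finset.induction_on with
  | empty => simpa using Rd.zero
  | insert a s ha ih => simpa [Finset.sum_insert ha] using (hf a).add ih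

theorem Rd.sq {f : V3 → ℝ} (hf : Rd f) : Rd (fun v => f v ^ 2) := by
  simpa [pow_two] using hf.mul_pg hf.pg

/-- the model weight `(‖z‖⁻¹+‖z‖)²` against a high negative power. -/
theorem integrable_sing : Integrable (fun z : V3 => (‖z‖⁻¹ + ‖z‖) ^ 2 * ((1 + ‖z‖) ^ 8)⁻¹) := by
  have := (integrable_fun_norm_addHaar (E := V3) (F := ℝ) volume
    (f := fun y => (y⁻¹ + y) ^ 2 * ((1 + y) ^ 8)⁻¹)).2 ?_
  · exact this
  · have hd : Module.finrank ℝ V3 - 1 = 2 := by simp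
    rw [hd]
    have h2 : Integrable (fun y : ℝ => 4 * (1 + ‖y‖) ^ (-(2:ℝ))) :=
      (integrable_one_add_norm (by simp)).const_mul 4
    refine Integrable.mono' h2.integrableOn ?_ ?_
    · apply Measurable.aestronglyMeasurable; fun_prop
    · refine (ae_restrict_iff' measurableSet_Ioi).2 (Filter.Eventually.of_forall fun y hy => ?_)
      have hy : 0 < y := hy
      have e : (1 + ‖y‖) ^ (-(2:ℝ)) = ((1 + y) ^ 2)⁻¹ := by
        rw [Real.norm_of_nonneg hy.le, Real.rpow_neg (by positivity)]; norm_cast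
      rw [e, smul_eq_mul, Real.norm_of_nonneg (by positivity)]
      have : y ^ 2 * ((y⁻¹ + y) ^ 2 * ((1 + y) ^ 8)⁻¹) = (1 + y^2)^2 * ((1 + y) ^ 8)⁻¹ := by
        field_simp
      rw [this, ← div_eq_mul_inv, ← div_eq_mul_inv, div_le_div_iff₀ (by positivity) (by positivity)]
      have a1 : 1 + y^2 ≤ (1+y)^2 := by nlinarith
      calc (1 + y^2)^2 * (1+y)^2 ≤ ((1+y)^2)^2 * (1+y)^2 := by gcongr
        _ = 1 * (1+y)^6 := by ring
        _ ≤ 4 * (1+y)^8 := by gcongr <;> linarith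

theorem Rd.integrable {f : V3 → ℝ} (hf : Rd f) : Integrable f := by
  obtain ⟨C, hC⟩ := hf.2 4
  have h2 : Integrable (fun y : V3 => C * (1 + ‖y‖) ^ (-(4:ℝ))) :=
      (integrable_one_add_norm (by simp; norm_num)).const_mul C
  refine Integrable.mono' h2 hf.1.aestronglyMeasurable (Filter.Eventually.of_forall fun v => ?_)
  have e : (1 + ‖v‖) ^ (-(4:ℝ)) = ((1 + ‖v‖) ^ 4)⁻¹ := by
    rw [Real.rpow_neg (by positivity)]; norm_cast
  rw [e, ← div_eq_mul_inv, le_div_iff₀ (by positivity)]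
  exact hC v

/-- singular kernels -/
def Sk (k : V3 → ℝ) : Prop := Measurable k ∧ ∃ C : ℝ, 0 ≤ C ∧ ∀ z, |k z| ≤ C * (‖z‖⁻¹ + ‖z‖) ^ 2

theorem peetre (v z : V3) : 1 + ‖z‖ ≤ (1 + ‖v‖) * (1 + ‖v - z‖) := by
  have : ‖z‖ ≤ ‖v‖ + ‖v - z‖ := by
    calc ‖z‖ = ‖v - (v - z)‖ := by simp
      _ ≤ _ := norm_sub_le _ _
  nlinarith [norm_nonneg v, norm_nonneg (v - z)]

theorem Rd.shift_bound {f : V3 → ℝ} (hf : Rd f) (N : ℕ) :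
    ∃ C : ℝ, 0 ≤ C ∧ ∀ v z, |f (v - z)| ≤ C * (1 + ‖v‖) ^ N * ((1 + ‖z‖) ^ N)⁻¹ := by
  obtain ⟨C, hC⟩ := hf.2 N
  have hC0 : 0 ≤ C := le_trans (by positivity) (hC 0)
  refine ⟨C, hC0, fun v z => ?_⟩
  rw [← div_eq_mul_inv, le_div_iff₀ (by positivity)]
  calc |f (v - z)| * (1 + ‖z‖) ^ N ≤ |f (v-z)| * ((1 + ‖v‖) * (1 + ‖v - z‖)) ^ N := by
        gcongr; exact peetre v z
    _ = |f (v-z)| * (1 + ‖v-z‖) ^ N * (1 + ‖v‖) ^ N := by rw [mul_pow]; ring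
    _ ≤ C * (1 + ‖v‖) ^ N := by gcongr; exact hC _

theorem Sk.dom {k f : V3 → ℝ} (hk : Sk k) (hf : Rd f) :
    ∃ C : ℝ, 0 ≤ C ∧ ∀ v z, |k z * f (v - z)| ≤
      C * (1 + ‖v‖) ^ 8 * ((‖z‖⁻¹ + ‖z‖) ^ 2 * ((1 + ‖z‖) ^ 8)⁻¹) := by
  obtain ⟨C, hC0, hC⟩ := hf.shift_bound 8
  obtain ⟨D, hD0, hD⟩ := hk.2
  refine ⟨D * C, by positivity, fun v z => ?_⟩
  rw [abs_mul]
  calc |k z| * |f (v - z)| ≤ (D * (‖z‖⁻¹ + ‖z‖) ^ 2) * (C * (1 + ‖v‖) ^ 8 * ((1 + ‖z‖) ^ 8)⁻¹) := by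
        gcongr
        · exact hD z
        · exact hC v z
    _ = _ := by ring

theorem Sk.integrable' {k f : V3 → ℝ} (hk : Sk k) (hf : Rd f) (v : V3) :
    Integrable (fun z => k z * f (v - z)) := by
  obtain ⟨C, hC0, hC⟩ := hk.dom hf
  refine Integrable.mono' (integrable_sing.const_mul (C * (1 + ‖v‖) ^ 8)) ?_
    (Filter.Eventually.of_forall fun z => hC v z)
  exact (hk.1.mul (hf.1.comp (measurable_const.sub measurable_id))).aestronglyMeasurable

/-- convolution -/
def cv (k f : V3 → ℝ) (v : V3) : ℝ := ∫ u : V3, k (v - u) * f u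

theorem cv_eq (k f : V3 → ℝ) (v : V3) : cv k f v = ∫ z : V3, k z * f (v - z) := by
  have := integral_sub_left_eq_self (μ := (volume : Measure V3)) (fun z => k z * f (v - z)) v
  rw [← this]
  simp [cv]

theorem Sk.integrable {k f : V3 → ℝ} (hk : Sk k) (hf : Rd f) (v : V3) :
    Integrable (fun u => k (v - u) * f u) := by
  have := (hk.integrable' hf v).comp_sub_left v
  simpa using this

theorem Sk.cv_pg {k f : V3 → ℝ} (hk : Sk k) (hf : Rd f) : Pg (cv k f) := by
  constructor
  · have : StronglyMeasurable (fun p : V3 × V3 => k (p.1 - p.2) * f p.2) := by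
      apply Measurable.stronglyMeasurable
      exact (hk.1.comp (measurable_fst.sub measurable_snd)).mul (hf.1.comp measurable_snd)
    exact (this.integral_prod_right' (ν := volume)).measurable
  · obtain ⟨C, hC0, hC⟩ := hk.dom hf
    refine ⟨C * ∫ z : V3, ((‖z‖⁻¹ + ‖z‖) ^ 2 * ((1 + ‖z‖) ^ 8)⁻¹), 8, fun v => ?_⟩
    rw [cv_eq]
    calc |∫ z : V3, k z * f (v - z)| ≤ ∫ z : V3, |k z * f (v - z)| := abs_integral_le_integral_abs
      _ ≤ ∫ z : V3, C * (1 + ‖v‖) ^ 8 * ((‖z‖⁻¹ + ‖z‖) ^ 2 * ((1 + ‖z‖) ^ 8)⁻¹) :=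
          integral_mono (hk.integrable' hf v).abs (integrable_sing.const_mul _) (fun z => hC v z)
      _ = _ := by rw [integral_const_mul]; ring

/-- differentiable, polynomial growth with derivative -/
def PS (f : V3 → ℝ) : Prop := Differentiable ℝ f ∧ Pg f ∧ Pg (fun v => ‖fderiv ℝ f v‖)

/-- differentiable, rapid decay with derivative -/
def Sm (f : V3 → ℝ) : Prop := Differentiable ℝ f ∧ Rd f ∧ Rd (fun v => ‖fderiv ℝ f v‖)

theorem meas_nf (f : V3 → ℝ) : Measurable (fun v => ‖fderiv ℝ f v‖) :=
  (measurable_fderiv ℝ f).norm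

theorem Sm.ps {f : V3 → ℝ} (h : Sm f) : PS f := ⟨h.1, h.2.1.pg, h.2.2.pg⟩

theorem meas_pd (f : V3 → ℝ) (i : Fin 3) : Measurable (pd i f) :=
  measurable_fderiv_apply_const ℝ f _

theorem abs_pd_le (f : V3 → ℝ) (i : Fin 3) (v : V3) : |pd i f v| ≤ ‖fderiv ℝ f v‖ := by
  have := (fderiv ℝ f v).le_opNorm (EuclideanSpace.single i 1)
  simpa [pd] using this

theorem PS.pd {f : V3 → ℝ} (h : PS f) (i : Fin 3) : Pg (pd i f) :=
  Pg.mono (meas_pd f i) h.2.2 (fun v => by simpa using abs_pd_le f i v)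

theorem Sm.pd {f : V3 → ℝ} (h : Sm f) (i : Fin 3) : Rd (pd i f) :=
  Rd.mono (meas_pd f i) h.2.2 (fun v => by simpa using abs_pd_le f i v)

theorem pd_add {f g : V3 → ℝ} (hf : Differentiable ℝ f) (hg : Differentiable ℝ g) (i : Fin 3)
    (v : V3) : pd i (fun w => f w + g w) v = pd i f v + pd i g v := by
  have := ((hf v).hasFDerivAt.add (hg v).hasFDerivAt).fderiv
  unfold pd
  rw [show (fun w => f w + g w) = f + g from rfl, this]; simp

theorem pd_mul {f g : V3 → ℝ} (hf : Differentiable ℝ f) (hg : Differentiable ℝ g) (i : Fin 3)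
    (v : V3) : pd i (fun w => f w * g w) v = pd i f v * g v + f v * pd i g v := by
  have := ((hf v).hasFDerivAt.mul (hg v).hasFDerivAt).fderiv
  unfold pd
  rw [show (fun w => f w * g w) = f * g from rfl, this]; simp; ring

theorem pd_sum {ι : Type*} (s : Finset ι) {f : ι → V3 → ℝ} (hf : ∀ j, Differentiable ℝ (f j))
    (i : Fin 3) (v : V3) : pd i (fun w => ∑ j ∈ s, f j w) v = ∑ j ∈ s, pd i (f j) v := by
  unfold pd
  rw [fderiv_fun_sum (fun j _ => hf j v)]
  simp

theorem pd_neg (f : V3 → ℝ) (i : Fin 3) (v : V3) : pd i (fun w => - f w) v = - pd i f v := by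
  unfold pd
  rw [fderiv_fun_neg]; simp

theorem pd_const (c : ℝ) (i : Fin 3) (v : V3) : pd i (fun _ => c) v = 0 := by
  unfold pd; simp

theorem pd_coord (i j : Fin 3) (v : V3) :
    pd i (fun w => w j) v = if i = j then 1 else 0 := by
  unfold pd
  have : HasFDerivAt (fun w : V3 => w j) (EuclideanSpace.proj j : V3 →L[ℝ] ℝ) v :=
    (EuclideanSpace.proj j : V3 →L[ℝ] ℝ).hasFDerivAt
  rw [this.fderiv]
  simp [eq_comm]

theorem PS.const (c : ℝ) : PS (fun _ => c) :=
  ⟨differentiable_const c, Pg.const c, by simpa using Pg.const 0⟩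

theorem PS.coord (j : Fin 3) : PS (fun w => w j) := by
  have : ∀ v, HasFDerivAt (fun w : V3 => w j) (EuclideanSpace.proj j : V3 →L[ℝ] ℝ) v := fun v =>
    (EuclideanSpace.proj j : V3 →L[ℝ] ℝ).hasFDerivAt
  refine ⟨fun v => (this v).differentiableAt, Pg.coord j, ?_⟩
  have e : (fun v => ‖fderiv ℝ (fun w : V3 => w j) v‖)
      = fun _ => ‖(EuclideanSpace.proj j : V3 →L[ℝ] ℝ)‖ := by
    funext v; rw [(this v).fderiv]
  rw [e]; exact Pg.const _

theorem PS.add {f g : V3 → ℝ} (hf : PS f) (hg : PS g) : PS (fun v => f v + g v) := by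
  refine ⟨hf.1.add hg.1, hf.2.1.add hg.2.1, Pg.mono (meas_nf _) (hf.2.2.add hg.2.2) fun v => ?_⟩
  rw [fderiv_fun_add (hf.1 v) (hg.1 v), abs_norm, abs_of_nonneg (by positivity)]
  exact norm_add_le _ _

theorem Sm.add {f g : V3 → ℝ} (hf : Sm f) (hg : Sm g) : Sm (fun v => f v + g v) := by
  refine ⟨hf.1.add hg.1, hf.2.1.add hg.2.1, Rd.mono (meas_nf _) (hf.2.2.add hg.2.2) fun v => ?_⟩
  rw [fderiv_fun_add (hf.1 v) (hg.1 v), abs_norm, abs_of_nonneg (by positivity)]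
  exact norm_add_le _ _

theorem norm_fderiv_mul_le {f g : V3 → ℝ} (hf : Differentiable ℝ f) (hg : Differentiable ℝ g)
    (v : V3) : |‖fderiv ℝ (fun w => f w * g w) v‖| ≤
      |(|f v| * ‖fderiv ℝ g v‖ + |g v| * ‖fderiv ℝ f v‖)| := by
  rw [fderiv_fun_mul (hf v) (hg v), abs_norm, abs_of_nonneg (by positivity)]
  refine (norm_add_le _ _).trans ?_
  simp [norm_smul]

theorem PS.mul {f g : V3 → ℝ} (hf : PS f) (hg : PS g) : PS (fun v => f v * g v) :=
  ⟨hf.1.mul hg.1, hf.2.1.mul hg.2.1, Pg.mono (meas_nf _)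
    ((hf.2.1.abs.mul hg.2.2).add (hg.2.1.abs.mul hf.2.2)) (norm_fderiv_mul_le hf.1 hg.1)⟩

theorem Sm.mul {f g : V3 → ℝ} (hf : Sm f) (hg : PS g) : Sm (fun v => f v * g v) :=
  ⟨hf.1.mul hg.1, hf.2.1.mul_pg hg.2.1, Rd.mono (meas_nf _)
    ((hf.2.1.abs.mul_pg hg.2.2).add (hg.2.1.abs.mul_rd hf.2.2)) (norm_fderiv_mul_le hf.1 hg.1)⟩

theorem PS.mul_sm {f g : V3 → ℝ} (hf : PS f) (hg : Sm g) : Sm (fun v => f v * g v) := by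
  simpa [mul_comm] using hg.mul hf

theorem PS.neg {f : V3 → ℝ} (hf : PS f) : PS (fun v => - f v) := by
  simpa using (PS.const (-1)).mul hf

theorem PS.sub {f g : V3 → ℝ} (hf : PS f) (hg : PS g) : PS (fun v => f v - g v) := by
  simpa [sub_eq_add_neg] using hf.add hg.neg

theorem PS.sum {ι : Type*} (s : Finset ι) {f : ι → V3 → ℝ} (hf : ∀ i, PS (f i)) :
    PS (fun v => ∑ i ∈ s, f i v) := by
  classical
  induction s using Finset.induction_on with
  | empty => simpa using PS.const 0
  | insert a s ha ih => simpa [Finset.sum_insert ha] using (hf a).add ih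

/-- integration by parts -/
theorem ibp {a f : V3 → ℝ} (ha : PS a) (hf : Sm f) (i : Fin 3) :
    ∫ v, a v * pd i f v = - ∫ v, pd i a v * f v := by
  apply integral_mul_fderiv_eq_neg_fderiv_mul_of_integrable
  · exact ((ha.pd i).mul_rd hf.2.1).integrable
  · exact (ha.2.1.mul_rd (hf.pd i)).integrable
  · exact (ha.2.1.mul_rd hf.2.1).integrable
  · exact fun x _ => ha.1 x
  · exact fun x _ => hf.1 x

theorem Sk.hasFDerivAt {k f : V3 → ℝ} (hk : Sk k) (hf : Sm f) (v : V3) :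
    HasFDerivAt (cv k f) (∫ z, k z • fderiv ℝ f (v - z)) v ∧
      Integrable (fun z => k z • fderiv ℝ f (v - z)) := by
  have e : cv k f = fun v => ∫ z, k z * f (v - z) := funext (cv_eq k f)
  obtain ⟨C, hC0, hC⟩ := hk.dom hf.2.2
  have hm : ∀ v, AEStronglyMeasurable (fun z => k z • fderiv ℝ f (v - z)) volume := fun v => by
    apply Measurable.aestronglyMeasurable
    exact hk.1.smul ((measurable_fderiv ℝ f).comp (measurable_const.sub measurable_id))
  have hn : ∀ w z, ‖k z • fderiv ℝ f (w - z)‖ ≤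
      C * (1 + ‖w‖) ^ 8 * ((‖z‖⁻¹ + ‖z‖) ^ 2 * ((1 + ‖z‖) ^ 8)⁻¹) := fun w z => by
    refine le_trans (le_of_eq ?_) (hC w z)
    rw [norm_smul, abs_mul, abs_norm, Real.norm_eq_abs]
  refine ⟨?_, Integrable.mono' (integrable_sing.const_mul (C * (1 + ‖v‖) ^ 8)) (hm v)
    (Filter.Eventually.of_forall (hn v))⟩
  rw [e]
  refine hasFDerivAt_integral_of_dominated_of_fderiv_le
    (bound := fun z => C * (1 + (‖v‖ + 1)) ^ 8 * ((‖z‖⁻¹ + ‖z‖) ^ 2 * ((1 + ‖z‖) ^ 8)⁻¹))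
    (F' := fun w z => k z • fderiv ℝ f (w - z))
    (Metric.ball_mem_nhds v one_pos) ?_ (hk.integrable' hf.2.1 v) (hm v) ?_ ?_ ?_
  · exact Filter.Eventually.of_forall fun w => (hk.integrable' hf.2.1 w).aestronglyMeasurable
  · refine Filter.Eventually.of_forall fun z w hw => (hn w z).trans ?_
    have : ‖w‖ ≤ ‖v‖ + 1 := by
      have h1 : ‖w - v‖ < 1 := by simpa [dist_eq_norm] using hw
      have := norm_le_norm_add_norm_sub' w v
      linarith
    gcongr
  · exact integrable_sing.const_mul _
  · refine Filter.Eventually.of_forall fun z w _ => ?_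
    have := ((hf.1 (w - z)).hasFDerivAt.comp w ((hasFDerivAt_id w).sub_const z)).const_mul (k z)
    simpa using this

theorem Sk.pd_cv {k f : V3 → ℝ} (hk : Sk k) (hf : Sm f) (i : Fin 3) (v : V3) :
    pd i (cv k f) v = cv k (pd i f) v := by
  obtain ⟨h1, h2⟩ := hk.hasFDerivAt hf v
  have : pd i (cv k f) v = (∫ z, k z • fderiv ℝ f (v - z)) (EuclideanSpace.single i 1) := by
    unfold pd; rw [h1.fderiv]
  rw [this, ContinuousLinearMap.integral_apply h2, cv_eq]
  rfl

theorem Sk.abs {k : V3 → ℝ} (hk : Sk k) : Sk (fun z => |k z|) :=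
  ⟨hk.1.abs, by simpa using hk.2⟩

theorem Sk.cv_ps {k f : V3 → ℝ} (hk : Sk k) (hf : Sm f) : PS (cv k f) := by
  refine ⟨fun v => (hk.hasFDerivAt hf v).1.differentiableAt, hk.cv_pg hf.2.1, ?_⟩
  refine Pg.mono (meas_nf _) (hk.abs.cv_pg hf.2.2) fun v => ?_
  rw [(hk.hasFDerivAt hf v).1.fderiv, abs_norm]
  refine le_trans (norm_integral_le_integral_norm _) (le_trans (le_of_eq ?_) (le_abs_self _))
  rw [cv_eq]
  simp [norm_smul]

/-- Gaussians -/
def gau (a : ℝ) (v : V3) : ℝ := Real.exp (-a * ‖v‖ ^ 2)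

theorem gau_hasFDerivAt (a : ℝ) (v : V3) :
    HasFDerivAt (gau a) ((-2 * a * gau a v) • (innerSL ℝ v : V3 →L[ℝ] ℝ)) v := by
  have h1 : HasFDerivAt (fun v : V3 => ‖v‖ ^ 2) (2 • (innerSL ℝ v : V3 →L[ℝ] ℝ)) v :=
    (hasStrictFDerivAt_norm_sq v).hasFDerivAt
  have h2 := (h1.const_mul (-a)).exp
  refine HasFDerivAt.congr_fderiv (f := gau a) h2 ?_
  rw [← Nat.cast_smul_eq_nsmul ℝ, smul_smul, smul_smul]
  congr 1
  unfold gau; push_cast; ring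

theorem gau_pos (a : ℝ) (v : V3) : 0 < gau a v := Real.exp_pos _

theorem pd_gau (a : ℝ) (i : Fin 3) (v : V3) : pd i (gau a) v = -2 * a * v i * gau a v := by
  unfold pd
  rw [(gau_hasFDerivAt a v).fderiv]
  simp [PiLp.inner_apply]; ring

theorem gau_rd {a : ℝ} (ha : 0 < a) : Rd (gau a) := by
  refine ⟨(by unfold gau; fun_prop), fun N => ⟨Real.exp (N ^ 2 / (4 * a)), fun v => ?_⟩⟩
  rw [abs_of_pos (gau_pos a v)]
  have h1 : (1 + ‖v‖) ^ N ≤ Real.exp (N * ‖v‖) := by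
    rw [Real.exp_nat_mul]
    gcongr
    linarith [Real.add_one_le_exp ‖v‖]
  calc gau a v * (1 + ‖v‖) ^ N ≤ gau a v * Real.exp (N * ‖v‖) := by
        have := (gau_pos a v).le; gcongr
    _ = Real.exp (-a * ‖v‖ ^ 2 + N * ‖v‖) := by rw [gau, ← Real.exp_add]
    _ ≤ _ := by
      apply Real.exp_le_exp.2
      rw [le_div_iff₀ (by positivity)]
      nlinarith [sq_nonneg (2 * a * ‖v‖ - N)]

theorem gau_sm {a : ℝ} (ha : 0 < a) : Sm (gau a) := by
  refine ⟨fun v => (gau_hasFDerivAt a v).differentiableAt, gau_rd ha, ?_⟩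
  refine Rd.mono (meas_nf _) ((Pg.const (2*a)).mul_rd ((gau_rd ha).mul_pg Pg.norm)) fun v => ?_
  rw [(gau_hasFDerivAt a v).fderiv, norm_smul, innerSL_apply_norm]
  simp only [abs_mul, abs_norm, norm_mul, Real.norm_eq_abs, abs_neg, abs_abs]
  exact le_of_eq (by ring)

theorem gau_moment {a : ℝ} (ha : 0 < a) (i j : Fin 3) :
    ∫ v, v i * v j * gau a v = (if i = j then 1 else 0) * ((2 * a)⁻¹ * ∫ v, gau a v) := by
  have h := ibp (PS.coord j) (gau_sm ha) i
  simp only [pd_gau, pd_coord, integral_const_mul] at h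
  have e : ∀ v : V3, v i * v j * gau a v = (-(2*a)⁻¹) * (v j * (-2 * a * v i * gau a v)) := by
    intro v; field_simp
  simp_rw [e, integral_const_mul, h]
  ring

theorem gau_moment1 {a : ℝ} (ha : 0 < a) (i : Fin 3) : ∫ v, v i * gau a v = 0 := by
  have h := ibp (PS.const 1) (gau_sm ha) i
  simp only [pd_gau, pd_const, zero_mul, integral_zero, neg_zero, one_mul] at h
  have e : ∀ v : V3, v i * gau a v = (-(2*a)⁻¹) * ((-2 * a * v i * gau a v)) := by
    intro v; field_simp
  simp_rw [e, integral_const_mul, h]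
  ring

theorem gau_int_pos {a : ℝ} (ha : 0 < a) : 0 < ∫ v, gau a v :=
  integral_exp_pos (gau_rd ha).integrable

theorem one_le_jap (v : V3) : 1 ≤ jap v := by
  unfold jap; rw [Real.one_le_sqrt]; nlinarith [sq_nonneg ‖v‖]

theorem jap_pos (v : V3) : 0 < jap v := lt_of_lt_of_le one_pos (one_le_jap v)

theorem jap_sq (v : V3) : jap v ^ 2 = 1 + ‖v‖ ^ 2 := Real.sq_sqrt (by positivity)

theorem norm_le_jap (v : V3) : ‖v‖ ≤ jap v := by
  have := jap_sq v
  nlinarith [norm_nonneg v, jap_pos v]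

theorem jap_le (v : V3) : jap v ≤ 1 + ‖v‖ := by
  have := jap_sq v
  nlinarith [norm_nonneg v, jap_pos v]

theorem le_jap (v : V3) : 1 + ‖v‖ ≤ 2 * jap v := by
  linarith [one_le_jap v, norm_le_jap v]

theorem japr (p : ℝ) (v : V3) : jap v ^ p = (1 + ‖v‖ ^ 2) ^ (p / 2) := by
  rw [jap, Real.sqrt_eq_rpow, ← Real.rpow_mul (by positivity)]; congr 1; ring

theorem jap_hasFDerivAt (p : ℝ) (v : V3) :
    HasFDerivAt (fun v => jap v ^ p) ((p * jap v ^ (p - 2)) • (innerSL ℝ v : V3 →L[ℝ] ℝ)) v := by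
  have h1 : HasFDerivAt (fun v : V3 => ‖v‖ ^ 2) (2 • (innerSL ℝ v : V3 →L[ℝ] ℝ)) v :=
    (hasStrictFDerivAt_norm_sq v).hasFDerivAt
  have h2 := (h1.const_add 1).rpow_const (p := p / 2) (Or.inl (by positivity))
  simp_rw [japr]
  refine h2.congr_fderiv ?_
  rw [← Nat.cast_smul_eq_nsmul ℝ, smul_smul]
  congr 1
  rw [show (p - 2) / 2 = p / 2 - 1 by ring]; push_cast; ring

theorem jap_pg (p : ℝ) : Pg (fun v => jap v ^ p) := by
  refine ⟨?_, 1, ⌈|p|⌉₊, fun v => ?_⟩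
  · unfold jap; fun_prop
  · rw [abs_of_pos (Real.rpow_pos_of_pos (jap_pos v) p), one_mul, ← Real.rpow_natCast]
    calc jap v ^ p ≤ jap v ^ (⌈|p|⌉₊ : ℝ) :=
          Real.rpow_le_rpow_of_exponent_le (one_le_jap v) ((le_abs_self p).trans (Nat.le_ceil _))
      _ ≤ _ := Real.rpow_le_rpow (jap_pos v).le (jap_le v) (by positivity)

theorem jap_ps (p : ℝ) : PS (fun v => jap v ^ p) := by
  refine ⟨fun v => (jap_hasFDerivAt p v).differentiableAt, jap_pg p, ?_⟩
  refine Pg.mono (meas_nf _) (((Pg.const p).mul (jap_pg (p-2))).mul Pg.norm) fun v => ?_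
  rw [(jap_hasFDerivAt p v).fderiv, norm_smul, innerSL_apply_norm]
  simp [abs_mul]

theorem pd_jap (p : ℝ) (i : Fin 3) (v : V3) :
    pd i (fun v => jap v ^ p) v = p * jap v ^ (p - 2) * v i := by
  unfold pd
  rw [(jap_hasFDerivAt p v).fderiv]
  simp [EuclideanSpace.inner_single_right]

theorem schwartz_rd {F : Type*} [NormedAddCommGroup F] [NormedSpace ℝ F]
    (g : SchwartzMap V3 F) : Rd (fun v => ‖g v‖) := by
  refine ⟨g.continuous.norm.measurable, fun N => ?_⟩
  have h := fun v => SchwartzMap.one_add_le_sup_seminorm_apply (𝕜 := ℝ) (m := (N, 0)) (k := N)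
    (n := 0) le_rfl le_rfl g v
  refine ⟨_, fun v => le_trans (le_of_eq ?_) (h v)⟩
  simp [mul_comm]

theorem schwartz_sm (g : SchwartzMap V3 ℝ) : Sm g := by
  refine ⟨g.differentiable, ?_, ?_⟩
  · exact Rd.mono g.continuous.measurable (schwartz_rd g) (fun v => by simp)
  · exact schwartz_rd (SchwartzMap.fderivCLM ℝ V3 ℝ g)

theorem schwartz_pd (g : SchwartzMap V3 ℝ) (i : Fin 3) : Sm (pd i g) :=
  schwartz_sm ((SchwartzMap.evalCLM ℝ V3 ℝ (EuclideanSpace.single i (1:ℝ)))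
    (SchwartzMap.fderivCLM ℝ V3 ℝ g))

theorem mu0_eq : mu0 = fun v => (2 * π) ^ (-(3 : ℝ) / 2) * gau (1/2) v := by
  funext v; unfold mu0 gau; congr 2; ring

/-- normalizing constant of `mu0` -/
def cmu : ℝ := (2 * π) ^ (-(3 : ℝ) / 2)

theorem cmu_pos : 0 < cmu := by unfold cmu; positivity

theorem mu0_eq' (v : V3) : mu0 v = cmu * gau (1/2) v := by rw [mu0_eq]; rfl

theorem sqmu_eq (v : V3) : sqmu v = √cmu * gau (1/4) v := by
  unfold sqmu
  rw [mu0_eq', Real.sqrt_mul cmu_pos.le]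
  congr 1
  unfold gau
  rw [← Real.exp_half]; congr 1; ring

theorem sqmu_sq (v : V3) : sqmu v * sqmu v = mu0 v :=
  Real.mul_self_sqrt (by rw [mu0_eq']; exact (mul_pos cmu_pos (gau_pos _ _)).le)

theorem sqmu_pos (v : V3) : 0 < sqmu v := by
  rw [sqmu_eq]; exact mul_pos (Real.sqrt_pos.2 cmu_pos) (gau_pos _ _)

theorem mu0_pos (v : V3) : 0 < mu0 v := by
  rw [mu0_eq']; exact mul_pos cmu_pos (gau_pos _ _)

theorem mu0_sm : Sm mu0 := by
  rw [mu0_eq]; exact (PS.const _).mul_sm (gau_sm (by norm_num))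

theorem sqmu_sm : Sm sqmu := by
  rw [show sqmu = _ from funext sqmu_eq]; exact (PS.const _).mul_sm (gau_sm (by norm_num))

theorem pd_mu0 (i : Fin 3) (v : V3) : pd i mu0 v = - v i * mu0 v := by
  rw [show mu0 = _ from funext mu0_eq',
    pd_mul (differentiable_const _) (gau_sm (by norm_num)).1, pd_const, pd_gau]; ring

theorem pd_sqmu (i : Fin 3) (v : V3) : pd i sqmu v = - (v i / 2) * sqmu v := by
  rw [show sqmu = _ from funext sqmu_eq,
    pd_mul (differentiable_const _) (gau_sm (by norm_num)).1, pd_const, pd_gau]; ring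

theorem nsq (z : V3) : ‖z‖ ^ 2 = z 0 ^ 2 + z 1 ^ 2 + z 2 ^ 2 := by
  rw [EuclideanSpace.real_norm_sq_eq, Fin.sum_univ_three]

/-- the quadratic form `|z|²|ξ|² - (z·ξ)²` -/
def Qf (ξ : Fin 3 → ℝ) (z : V3) : ℝ := ‖z‖ ^ 2 * ∑ i, ξ i ^ 2 - (∑ i, z i * ξ i) ^ 2

theorem Qf_nonneg (ξ : Fin 3 → ℝ) (z : V3) : 0 ≤ Qf ξ z := by
  unfold Qf
  rw [nsq]; simp only [Fin.sum_univ_three]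
  nlinarith [sq_nonneg (z 0 * ξ 1 - z 1 * ξ 0), sq_nonneg (z 0 * ξ 2 - z 2 * ξ 0),
    sq_nonneg (z 1 * ξ 2 - z 2 * ξ 1)]

/-- Abstract properties of the kernels. -/
structure KH (ker : V3 → Fin 3 → Fin 3 → ℝ) (n : ℕ) : Prop where
  meas : ∀ i j, Measurable fun z => ker z i j
  symm : ∀ z i j, ker z i j = ker z j i
  bd : ∀ z i j, |ker z i j| ≤ 2 * (‖z‖⁻¹ + ‖z‖)
  null : ∀ z i, ∑ j, ker z i j * z j = 0
  low : ∀ v u ξ, ((2 * jap v) ^ (n + 1))⁻¹ * gau (((n + 1 : ℕ) : ℝ) / 2) u * Qf ξ (v - u) ≤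
    ∑ i, ∑ j, ker (v - u) i j * (ξ i * ξ j)
  diff : ∀ v u i j, ‖v‖ ^ n * |ker (v - u) i j - ker v i j| ≤
    10 * (‖u‖ + ‖u‖ ^ 2 * ‖v - u‖⁻¹)

theorem kerR_eq (z : V3) (i j : Fin 3) :
    kerR z i j = ((if i = j then 1 else 0) * ‖z‖ ^ 2 - z i * z j) * ‖z‖⁻¹ := by
  unfold kerR
  by_cases h : ‖z‖ = 0
  · simp [h]
  · field_simp

theorem kerC_eq (z : V3) (i j : Fin 3) : kerC z i j = kerR z i j * (‖z‖ ^ 2)⁻¹ := by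
  unfold kerC kerR
  by_cases h : ‖z‖ = 0
  · simp [h]
  · field_simp

theorem kerR_bd (z : V3) (i j : Fin 3) : |kerR z i j| ≤ 2 * ‖z‖ := by
  by_cases h : ‖z‖ = 0
  · simp [kerR, h]
  have hp : 0 < ‖z‖ := lt_of_le_of_ne (norm_nonneg _) (Ne.symm h)
  rw [kerR_eq, abs_mul, abs_of_pos (inv_pos.2 hp), ← div_eq_mul_inv, div_le_iff₀ hp]
  have h1 : |z i * z j| ≤ ‖z‖ * ‖z‖ := by
    rw [abs_mul]; exact mul_le_mul (abs_coord_le z i) (abs_coord_le z j) (abs_nonneg _) hp.le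
  have h2 : |(if i = j then (1:ℝ) else 0) * ‖z‖ ^ 2| ≤ ‖z‖ * ‖z‖ := by
    split_ifs
    · rw [one_mul, abs_of_nonneg (by positivity)]; exact le_of_eq (by ring)
    · simp; positivity
  rw [abs_le] at *
  constructor <;> linarith [h1.1, h1.2, h2.1, h2.2]

theorem kerR_symm (z : V3) (i j : Fin 3) : kerR z i j = kerR z j i := by
  rw [kerR_eq, kerR_eq]; simp only [eq_comm, mul_comm]

theorem kerR_null (z : V3) (i : Fin 3) : ∑ j, kerR z i j * z j = 0 := by
  have h : ∑ j, ((if i = j then 1 else 0) * ‖z‖ ^ 2 - z i * z j) * z j = 0 := by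
    have := nsq z
    fin_cases i <;> simp [Fin.sum_univ_three, this] <;> ring
  calc _ = (∑ j, ((if i = j then 1 else 0) * ‖z‖ ^ 2 - z i * z j) * z j) * ‖z‖⁻¹ := by
        rw [Finset.sum_mul]; exact Finset.sum_congr rfl fun j _ => by rw [kerR_eq]; ring
    _ = 0 := by rw [h, zero_mul]

theorem kerR_quad (z : V3) (ξ : Fin 3 → ℝ) :
    ∑ i, ∑ j, kerR z i j * (ξ i * ξ j) = Qf ξ z * ‖z‖⁻¹ := by
  simp only [kerR_eq, Qf]
  simp [Fin.sum_univ_three]; ring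

theorem kerR_meas (i j : Fin 3) : Measurable fun z => kerR z i j := by
  have h1 := measurable_coord i
  have h2 := measurable_coord j
  unfold kerR
  fun_prop

theorem kerR_diff (z v : V3) (i j : Fin 3) :
    |kerR z i j - kerR v i j| ≤ 4 * ‖z - v‖ := by
  by_cases hz : ‖z‖ = 0
  · have hz' : z = 0 := norm_eq_zero.1 hz
    have := kerR_bd v i j
    subst hz'
    have e : kerR 0 i j = 0 := by simp [kerR]
    rw [e, zero_sub, abs_neg, zero_sub, norm_neg]
    linarith [norm_nonneg v]
  by_cases hv : ‖v‖ = 0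
  · have hv' : v = 0 := norm_eq_zero.1 hv
    have := kerR_bd z i j
    subst hv'
    have e : kerR 0 i j = 0 := by simp [kerR]
    rw [e, sub_zero, sub_zero]
    linarith [norm_nonneg z]
  have hzp : 0 < ‖z‖ := lt_of_le_of_ne (norm_nonneg _) (Ne.symm hz)
  have hvp : 0 < ‖v‖ := lt_of_le_of_ne (norm_nonneg _) (Ne.symm hv)
  have hd : |‖z‖ - ‖v‖| ≤ ‖z - v‖ := abs_norm_sub_norm_le z v
  have hi : |z i - v i| ≤ ‖z - v‖ := by simpa using abs_coord_le (z - v) i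
  have hj : |z j - v j| ≤ ‖z - v‖ := by simpa using abs_coord_le (z - v) j
  have tj : |z j / ‖z‖| ≤ 1 := by
    rw [abs_div, abs_norm, div_le_one hzp]; exact abs_coord_le z j
  have ti : |v i / ‖v‖| ≤ 1 := by
    rw [abs_div, abs_norm, div_le_one hvp]; exact abs_coord_le v i
  have e : kerR z i j - kerR v i j = (if i = j then 1 else 0) * (‖z‖ - ‖v‖)
      - (z i - v i) * (z j / ‖z‖) - (v i / ‖v‖) * (z j - v j)
      + (v i / ‖v‖) * (z j / ‖z‖) * (‖z‖ - ‖v‖) := by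
    unfold kerR; field_simp; ring
  have a1 : |(if i = j then (1:ℝ) else 0) * (‖z‖ - ‖v‖)| ≤ ‖z - v‖ := by
    split_ifs
    · simpa using hd
    · simp
  have a2 : |(z i - v i) * (z j / ‖z‖)| ≤ ‖z - v‖ := by
    rw [abs_mul]; calc _ ≤ ‖z - v‖ * 1 := by gcongr
      _ = _ := by ring
  have a3 : |(v i / ‖v‖) * (z j - v j)| ≤ ‖z - v‖ := by
    rw [abs_mul]; calc _ ≤ 1 * ‖z - v‖ := by gcongr
      _ = _ := by ring
  have a4 : |(v i / ‖v‖) * (z j / ‖z‖) * (‖z‖ - ‖v‖)| ≤ ‖z - v‖ := by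
    rw [abs_mul, abs_mul]; calc _ ≤ 1 * 1 * ‖z - v‖ := by gcongr
      _ = _ := by ring
  rw [e]
  rw [abs_le] at *
  constructor <;> linarith [a1.1, a1.2, a2.1, a2.2, a3.1, a3.2, a4.1, a4.2]

theorem low_aux (n : ℕ) (v u : V3) (h : 0 < ‖v - u‖) :
    ((2 * jap v) ^ (n + 1))⁻¹ * gau (((n + 1 : ℕ) : ℝ) / 2) u ≤ (‖v - u‖ ^ (n+1))⁻¹ := by
  have h1 : ‖v - u‖ ≤ 2 * jap v * Real.exp (‖u‖ ^ 2 / 2) := by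
    have e1 : jap u ≤ Real.exp (‖u‖ ^ 2 / 2) := by
      have : jap u ^ 2 ≤ Real.exp (‖u‖ ^ 2 / 2) ^ 2 := by
        rw [jap_sq, ← Real.exp_nat_mul]
        have := Real.add_one_le_exp (‖u‖ ^ 2)
        calc _ ≤ Real.exp (‖u‖ ^ 2) := by linarith
          _ = _ := by congr 1; push_cast; ring
      exact le_of_sq_le_sq this (Real.exp_pos _).le
    have e2 := norm_sub_le v u
    have e3 := norm_le_jap v
    have e4 := norm_le_jap u
    have e5 := one_le_jap v
    have e6 := one_le_jap u
    calc ‖v - u‖ ≤ 2 * jap v * jap u := by nlinarith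
      _ ≤ _ := by gcongr
  have h2 : gau (((n + 1 : ℕ) : ℝ) / 2) u = ((Real.exp (‖u‖ ^ 2 / 2)) ^ (n + 1))⁻¹ := by
    rw [← Real.exp_nat_mul, ← Real.exp_neg, gau]; congr 1; ring
  rw [h2, ← mul_inv, ← mul_pow]
  gcongr

theorem KH_R : KH kerR 0 where
  meas := kerR_meas
  symm := kerR_symm
  bd z i j := by
    have := kerR_bd z i j
    have h : 0 ≤ ‖z‖⁻¹ := by positivity
    linarith
  null := kerR_null
  low v u ξ := by
    rw [kerR_quad, mul_comm (Qf _ _)]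
    by_cases h : ‖v - u‖ = 0
    · have : v - u = 0 := norm_eq_zero.1 h
      simp [this, Qf]
    · have := low_aux 0 v u (lt_of_le_of_ne (norm_nonneg _) (Ne.symm h))
      simp only [zero_add, pow_one] at this ⊢
      exact mul_le_mul_of_nonneg_right this (Qf_nonneg _ _)
  diff v u i j := by
    have := kerR_diff (v - u) v i j
    have e : ‖v - u - v‖ = ‖u‖ := by rw [← norm_neg]; congr 1; abel
    rw [e] at this
    have h : 0 ≤ ‖u‖ ^ 2 * ‖v - u‖⁻¹ := by positivity
    simp only [pow_zero, one_mul]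
    linarith [norm_nonneg u]

theorem KH_C : KH kerC 2 where
  meas i j := by
    simp_rw [kerC_eq]
    have := kerR_meas i j
    fun_prop
  symm z i j := by rw [kerC_eq, kerC_eq, kerR_symm]
  bd z i j := by
    rw [kerC_eq, abs_mul, abs_of_nonneg (by positivity : 0 ≤ (‖z‖ ^ 2)⁻¹)]
    have h0 : ‖z‖ * (‖z‖ ^ 2)⁻¹ = ‖z‖⁻¹ := by
      by_cases h : ‖z‖ = 0
      · simp [h]
      · field_simp
    calc _ ≤ 2 * ‖z‖ * (‖z‖ ^ 2)⁻¹ := by gcongr; exact kerR_bd z i j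
      _ = 2 * ‖z‖⁻¹ := by rw [mul_assoc, h0]
      _ ≤ _ := by linarith [norm_nonneg z]
  null z i := by
    calc _ = (∑ j, kerR z i j * z j) * (‖z‖ ^ 2)⁻¹ := by
          rw [Finset.sum_mul]; exact Finset.sum_congr rfl fun j _ => by rw [kerC_eq]; ring
      _ = 0 := by rw [kerR_null, zero_mul]
  low v u ξ := by
    have e : ∑ i, ∑ j, kerC (v - u) i j * (ξ i * ξ j) = (‖v - u‖ ^ 3)⁻¹ * Qf ξ (v - u) := by
      calc _ = (∑ i, ∑ j, kerR (v - u) i j * (ξ i * ξ j)) * (‖v - u‖ ^ 2)⁻¹ := by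
            simp only [Finset.sum_mul]
            refine Finset.sum_congr rfl fun i _ => Finset.sum_congr rfl fun j _ => ?_
            rw [kerC_eq]; ring
        _ = _ := by rw [kerR_quad]; ring
    rw [e]
    by_cases h : ‖v - u‖ = 0
    · have : v - u = 0 := norm_eq_zero.1 h
      simp [this, Qf]
    · have := low_aux 2 v u (lt_of_le_of_ne (norm_nonneg _) (Ne.symm h))
      exact mul_le_mul_of_nonneg_right this (Qf_nonneg _ _)
  diff v u i j := by
    have h1 := kerR_diff (v - u) v i j
    have e : ‖v - u - v‖ = ‖u‖ := by rw [← norm_neg]; congr 1; abel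
    rw [e] at h1
    have h2 := kerR_bd (v - u) i j
    have hn : |‖v‖ - ‖v - u‖| ≤ ‖u‖ := by
      have := abs_norm_sub_norm_le v (v - u); simpa using this
    have hv0 : kerR v i j = ‖v‖ ^ 2 * kerC v i j := by
      rw [kerC_eq]
      by_cases h : ‖v‖ = 0
      · simp [kerR, h]
      · field_simp
    generalize hz : v - u = z at *
    have h0 : 0 ≤ ‖u‖ ^ 2 * ‖z‖⁻¹ := by positivity
    rw [← abs_of_nonneg (by positivity : 0 ≤ ‖v‖ ^ 2), ← abs_mul, mul_sub, ← hv0]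
    by_cases hzz : ‖z‖ = 0
    · have ez : kerR z i j = 0 := by simp [kerR, hzz]
      have ez' : kerC z i j = 0 := by simp [kerC, hzz]
      rw [ez] at h1
      rw [ez', mul_zero]
      linarith [norm_nonneg u]
    · have hp : 0 < ‖z‖ := lt_of_le_of_ne (norm_nonneg _) (Ne.symm hzz)
      have e2 : ‖v‖ ^ 2 * kerC z i j - kerR v i j =
          (kerR z i j - kerR v i j) + kerR z i j * (((‖v‖ - ‖z‖) * (‖v‖ + ‖z‖)) * (‖z‖ ^ 2)⁻¹) := by
        rw [kerC_eq]; field_simp; ring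
      have h3 : ‖v‖ ≤ ‖z‖ + ‖u‖ := by linarith [(abs_le.1 hn).2]
      rw [e2]
      calc _ ≤ |kerR z i j - kerR v i j| +
            |kerR z i j| * ((|‖v‖ - ‖z‖| * (‖v‖ + ‖z‖)) * (‖z‖ ^ 2)⁻¹) := by
            refine (abs_add_le _ _).trans (le_of_eq ?_)
            rw [abs_mul, abs_mul, abs_mul, abs_of_nonneg (by positivity : 0 ≤ ‖v‖ + ‖z‖),
              abs_of_nonneg (by positivity : 0 ≤ (‖z‖ ^ 2)⁻¹)]
        _ ≤ 4 * ‖u‖ + (2 * ‖z‖) * ((‖u‖ * ((‖z‖ + ‖u‖) + ‖z‖)) * (‖z‖ ^ 2)⁻¹) := by gcongr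
        _ = 8 * ‖u‖ + 2 * (‖u‖ ^ 2 * ‖z‖⁻¹) := by field_simp; ring
        _ ≤ _ := by linarith [norm_nonneg u]

theorem x_le_sq (z : V3) : ‖z‖⁻¹ + ‖z‖ ≤ (‖z‖⁻¹ + ‖z‖) ^ 2 := by
  by_cases h : ‖z‖ = 0
  · simp [h]
  have hp : 0 < ‖z‖ := lt_of_le_of_ne (norm_nonneg _) (Ne.symm h)
  have : 1 ≤ ‖z‖⁻¹ + ‖z‖ := by
    by_cases h1 : 1 ≤ ‖z‖
    · have : 0 ≤ ‖z‖⁻¹ := by positivity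
      linarith
    · have := (one_le_inv₀ hp).2 (by linarith)
      linarith
  nlinarith

theorem Sk_inv : Sk (fun z => ‖z‖⁻¹) := by
  refine ⟨by fun_prop, 1, by norm_num, fun z => ?_⟩
  rw [abs_of_nonneg (by positivity), one_mul]
  exact le_trans (by linarith [norm_nonneg z]) (x_le_sq z)

section
variable {ker : V3 → Fin 3 → Fin 3 → ℝ} {n : ℕ}

theorem KH.sk (hk : KH ker n) (i j : Fin 3) : Sk (fun z => ker z i j) :=
  ⟨hk.meas i j, 2, by norm_num, fun z => (hk.bd z i j).trans
    (mul_le_mul_of_nonneg_left (x_le_sq z) (by norm_num))⟩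

theorem KH.sk2 (hk : KH ker n) (i j : Fin 3) : Sk (fun z => ker z i j ^ 2) := by
  refine ⟨(hk.meas i j).pow_const 2, 4, by norm_num, fun z => ?_⟩
  rw [abs_pow]
  calc |ker z i j| ^ 2 ≤ (2 * (‖z‖⁻¹ + ‖z‖)) ^ 2 := by gcongr; exact hk.bd z i j
    _ = _ := by ring

/-- `φ * μ₀` -/
def sg (ker : V3 → Fin 3 → Fin 3 → ℝ) (v : V3) (i j : Fin 3) : ℝ :=
  ∫ u : V3, ker (v - u) i j * mu0 u

theorem KH.sg_ps (hk : KH ker n) (i j : Fin 3) : PS (fun v => sg ker v i j) :=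
  (hk.sk i j).cv_ps mu0_sm

theorem KH.sg_symm (hk : KH ker n) (v : V3) (i j : Fin 3) : sg ker v i j = sg ker v j i := by
  unfold sg; simp_rw [hk.symm _ i j]

theorem gau_mul (a b : ℝ) (v : V3) : gau a v * gau b v = gau (a + b) v := by
  unfold gau; rw [← Real.exp_add]; congr 1; ring

theorem Qf_int {a : ℝ} (ha : 0 < a) (ξ : Fin 3 → ℝ) (v : V3) :
    Integrable (fun u => Qf ξ (v - u) * gau a u) ∧
    a⁻¹ * (∫ u, gau a u) * ∑ i, ξ i ^ 2 ≤ ∫ u, Qf ξ (v - u) * gau a u := by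
  set s := ∑ i, ξ i ^ 2 with hs
  set t := ∑ i, v i * ξ i with ht
  have hG := gau_rd ha
  have e : ∀ u : V3, Qf ξ (v - u) * gau a u = Qf ξ v * gau a u
      + (∑ i, (-2 * (s * v i - t * ξ i)) * (u i * gau a u)
      + ∑ i, ∑ j, ((if i = j then s else 0) - ξ i * ξ j) * (u i * u j * gau a u)) := by
    intro u
    simp only [Qf, hs, ht, nsq, Fin.sum_univ_three, PiLp.sub_apply]
    simp
    ring
  have i1 : Integrable (fun u => Qf ξ v * gau a u) := hG.integrable.const_mul _
  have i2 : ∀ i, Integrable (fun u : V3 => (-2 * (s * v i - t * ξ i)) * (u i * gau a u)) :=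
    fun i => ((Pg.coord i).mul_rd hG).integrable.const_mul _
  have i3 : ∀ i j, Integrable (fun u : V3 =>
      ((if i = j then s else 0) - ξ i * ξ j) * (u i * u j * gau a u)) :=
    fun i j => (((Pg.coord i).mul (Pg.coord j)).mul_rd hG).integrable.const_mul _
  have i2' := integrable_finsetSum Finset.univ (fun i _ => i2 i)
  have i3' := integrable_finsetSum Finset.univ
    (fun i _ => integrable_finsetSum Finset.univ (fun j _ => i3 i j))
  have i23 : Integrable (fun u : V3 => ∑ i, (-2 * (s * v i - t * ξ i)) * (u i * gau a u)
      + ∑ i, ∑ j, ((if i = j then s else 0) - ξ i * ξ j) * (u i * u j * gau a u)) := i2'.add i3'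
  refine ⟨?_, ?_⟩
  · simp_rw [e]
    exact i1.add (i2'.add i3')
  · simp_rw [e]
    rw [integral_add i1 i23, integral_add i2' i3', integral_finsetSum _ (fun i _ => i2 i),
      integral_finsetSum _ (fun i _ => integrable_finsetSum Finset.univ (fun j _ => i3 i j))]
    simp_rw [integral_finsetSum _ (fun j _ => i3 _ j), integral_const_mul, gau_moment ha,
      gau_moment1 ha]
    have hq : 0 ≤ Qf ξ v * ∫ u, gau a u := mul_nonneg (Qf_nonneg _ _) (gau_int_pos ha).le
    generalize (∫ u, gau a u) = M at *
    simp only [hs, Fin.sum_univ_three] at *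
    simp
    ring_nf at *
    linarith

theorem KH.sg_quad (hk : KH ker n) (v : V3) (ξ : Fin 3 → ℝ) :
    Integrable (fun u => (∑ i, ∑ j, ker (v - u) i j * (ξ i * ξ j)) * mu0 u) ∧
    ∑ i, ∑ j, sg ker v i j * (ξ i * ξ j) =
      ∫ u, (∑ i, ∑ j, ker (v - u) i j * (ξ i * ξ j)) * mu0 u := by
  have e : ∀ u, (∑ i, ∑ j, ker (v - u) i j * (ξ i * ξ j)) * mu0 u =
      ∑ i, ∑ j, (ker (v - u) i j * mu0 u) * (ξ i * ξ j) := by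
    intro u
    simp only [Finset.sum_mul]
    exact Finset.sum_congr rfl fun i _ => Finset.sum_congr rfl fun j _ => by ring
  have i3 : ∀ i j, Integrable (fun u => (ker (v - u) i j * mu0 u) * (ξ i * ξ j)) :=
    fun i j => ((hk.sk i j).integrable mu0_sm.2.1 v).mul_const _
  simp_rw [e]
  refine ⟨integrable_finsetSum _ fun i _ => integrable_finsetSum _ fun j _ => i3 i j, ?_⟩
  rw [integral_finsetSum _ (fun i _ => integrable_finsetSum Finset.univ (fun j _ => i3 i j))]
  simp_rw [integral_finsetSum _ (fun j _ => i3 _ j), integral_mul_const]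
  rfl

theorem KH.sg_low (hk : KH ker n) : ∃ c > 0, ∀ v (ξ : Fin 3 → ℝ),
    c * (jap v ^ (n + 1))⁻¹ * ∑ i, ξ i ^ 2 ≤ ∑ i, ∑ j, sg ker v i j * (ξ i * ξ j) := by
  set a : ℝ := ((n + 1 : ℕ) : ℝ) / 2 + 1 / 2 with ha
  have ha0 : 0 < a := by positivity
  have hM := gau_int_pos ha0
  refine ⟨cmu * ((2:ℝ) ^ (n + 1))⁻¹ * (a⁻¹ * ∫ u, gau a u), ?_, fun v ξ => ?_⟩
  · have := cmu_pos; positivity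
  · obtain ⟨h1, h2⟩ := hk.sg_quad v ξ
    obtain ⟨h3, h4⟩ := Qf_int ha0 ξ v
    rw [h2]
    have hc : 0 ≤ ((2 * jap v) ^ (n + 1))⁻¹ * cmu := by
      have := cmu_pos; have := jap_pos v; positivity
    calc _ = (((2 * jap v) ^ (n + 1))⁻¹ * cmu) * (a⁻¹ * (∫ u, gau a u) * ∑ i, ξ i ^ 2) := by
          rw [mul_pow, mul_inv]; ring
      _ ≤ (((2 * jap v) ^ (n + 1))⁻¹ * cmu) * ∫ u, Qf ξ (v - u) * gau a u := by gcongr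
      _ = ∫ u, (((2 * jap v) ^ (n + 1))⁻¹ * cmu) * (Qf ξ (v - u) * gau a u) := by
          rw [integral_const_mul]
      _ ≤ _ := by
          refine integral_mono (h3.const_mul _) h1 fun u => ?_
          have := mul_le_mul_of_nonneg_right (hk.low v u ξ) (mu0_pos u).le
          refine le_trans (le_of_eq ?_) this
          rw [mu0_eq', ha, ← gau_mul]; ring

theorem cv_inv_bdd {f : V3 → ℝ} (hf : Rd f) : ∃ C : ℝ, ∀ v, cv (fun z => ‖z‖⁻¹) (fun u => |f u|) v ≤ C := by
  obtain ⟨S, hS⟩ := hf.2 0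
  have hS0 : 0 ≤ S := le_trans (by positivity) (hS 0)
  refine ⟨(∫ z : V3, S * 2 ^ 8 * ((‖z‖⁻¹ + ‖z‖) ^ 2 * ((1 + ‖z‖) ^ 8)⁻¹)) + ∫ z, |f z|, fun v => ?_⟩
  rw [cv_eq]
  have i1 : Integrable (fun z => |f (v - z)|) := hf.integrable.abs.comp_sub_left v
  have e : ∫ z, |f (v - z)| = ∫ z, |f z| := integral_sub_left_eq_self (fun z => |f z|) volume v
  rw [← e, ← integral_add (integrable_sing.const_mul _) i1]
  refine integral_mono (Sk_inv.integrable' hf.abs v) ((integrable_sing.const_mul _).add i1) fun z => ?_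
  have hs := hS (v - z)
  simp only [pow_zero, mul_one] at hs
  by_cases hz0 : ‖z‖ = 0
  · simp [hz0]
  have hp : 0 < ‖z‖ := lt_of_le_of_ne (norm_nonneg _) (Ne.symm hz0)
  by_cases h1 : ‖z‖ ≤ 1
  · have a1 : 1 ≤ 2 ^ 8 * ((1 + ‖z‖) ^ 8)⁻¹ := by
      rw [← div_eq_mul_inv, one_le_div (by positivity)]
      gcongr; linarith
    have a2 : ‖z‖⁻¹ ≤ (‖z‖⁻¹ + ‖z‖) ^ 2 := le_trans (by linarith) (x_le_sq z)
    have : ‖z‖⁻¹ * |f (v - z)| ≤ S * 2 ^ 8 * ((‖z‖⁻¹ + ‖z‖) ^ 2 * ((1 + ‖z‖) ^ 8)⁻¹) := by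
      calc ‖z‖⁻¹ * |f (v - z)| ≤ (‖z‖⁻¹ + ‖z‖) ^ 2 * S := by gcongr
        _ = ((‖z‖⁻¹ + ‖z‖) ^ 2 * S) * 1 := by ring
        _ ≤ ((‖z‖⁻¹ + ‖z‖) ^ 2 * S) * (2 ^ 8 * ((1 + ‖z‖) ^ 8)⁻¹) := by gcongr
        _ = _ := by ring
    have := abs_nonneg (f (v - z))
    simp only
    linarith
  · have a1 : ‖z‖⁻¹ ≤ 1 := inv_le_one_of_one_le₀ (by linarith)
    have : ‖z‖⁻¹ * |f (v - z)| ≤ 1 * |f (v - z)| := by gcongr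
    have : 0 ≤ S * 2 ^ 8 * ((‖z‖⁻¹ + ‖z‖) ^ 2 * ((1 + ‖z‖) ^ 8)⁻¹) := by positivity
    simp only
    linarith

theorem KH.cv_zero_mean (hk : KH ker n) (i j : Fin 3) {f : V3 → ℝ} (hf : Rd f)
    (h0 : ∫ u, f u = 0) :
    ∃ C : ℝ, ∀ v, |cv (fun z => ker z i j) f v| * jap v ^ n ≤ C := by
  obtain ⟨A, hA⟩ := cv_inv_bdd ((Pg.norm.pow 2).mul_rd hf)
  obtain ⟨B, N, hB0, hB⟩ := ((hk.sk i j).cv_pg hf).exists_nonneg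
  set I := ∫ u, ‖u‖ * |f u| with hI
  refine ⟨max (B * 2 ^ N * 2 ^ n) (2 ^ n * (10 * (I + A))), fun v => ?_⟩
  have hj := jap_le v
  have hj0 := jap_pos v
  by_cases h1 : ‖v‖ ≤ 1
  · refine le_trans ?_ (le_max_left _ _)
    have : 1 + ‖v‖ ≤ 2 := by linarith
    calc _ ≤ (B * (1 + ‖v‖) ^ N) * (1 + ‖v‖) ^ n := by gcongr; exact hB v
      _ ≤ _ := by gcongr
  · refine le_trans ?_ (le_max_right _ _)
    have e : cv (fun z => ker z i j) f v = ∫ u, (ker (v - u) i j - ker v i j) * f u := by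
      simp_rw [sub_mul]
      rw [integral_sub ((hk.sk i j).integrable hf v) (hf.integrable.const_mul _),
        integral_const_mul, h0]
      simp [cv]
    have ia : Integrable (fun u => ‖u‖ * |f u|) := (Pg.norm.mul_rd hf.abs).integrable
    have ib : Integrable (fun u => ‖v - u‖⁻¹ * |‖u‖ ^ 2 * f u|) :=
      Sk_inv.integrable ((Pg.norm.pow 2).mul_rd hf).abs v
    have key : ‖v‖ ^ n * |cv (fun z => ker z i j) f v| ≤ 10 * (I + A) := by
      have hA' := hA v
      calc _ ≤ ‖v‖ ^ n * ∫ u, |(ker (v - u) i j - ker v i j) * f u| := by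
            rw [e]; gcongr; exact abs_integral_le_integral_abs
        _ = ∫ u, ‖v‖ ^ n * |(ker (v - u) i j - ker v i j) * f u| := by rw [integral_const_mul]
        _ ≤ ∫ u, 10 * (‖u‖ * |f u| + ‖v - u‖⁻¹ * |‖u‖ ^ 2 * f u|) := by
            refine integral_mono_of_nonneg (Filter.Eventually.of_forall fun u => by positivity)
              ((ia.add ib).const_mul 10) (Filter.Eventually.of_forall fun u => ?_)
            have := mul_le_mul_of_nonneg_right (hk.diff v u i j) (abs_nonneg (f u))
            simp only [abs_mul, abs_pow, abs_norm]
            calc _ = _ := (mul_assoc _ _ _).symm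
              _ ≤ _ := this
              _ = _ := by ring
        _ = 10 * (I + cv (fun z => ‖z‖⁻¹) (fun u => |‖u‖ ^ 2 * f u|) v) := by
            rw [integral_const_mul, integral_add ia ib]; rfl
        _ ≤ _ := by gcongr
    calc _ ≤ |cv (fun z => ker z i j) f v| * (2 * ‖v‖) ^ n := by gcongr; linarith
      _ = 2 ^ n * (‖v‖ ^ n * |cv (fun z => ker z i j) f v|) := by rw [mul_pow]; ring
      _ ≤ _ := by gcongr

/-- `σ^i = σ^{ij} v_j` -/
theorem KH.sgi (hk : KH ker n) (i : Fin 3) (v : V3) :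
    ∑ j, sg ker v i j * v j = ∑ j, cv (fun z => ker z i j) (fun u => u j * mu0 u) v := by
  have ia : ∀ j, Integrable (fun u => ker (v - u) i j * mu0 u * v j) := fun j =>
    ((hk.sk i j).integrable mu0_sm.2.1 v).mul_const _
  have ib : ∀ j, Integrable (fun u => ker (v - u) i j * (u j * mu0 u)) := fun j =>
    ((hk.sk i j).integrable ((Pg.coord j).mul_rd mu0_sm.2.1) v)
  unfold sg cv
  simp_rw [← integral_mul_const]
  rw [← integral_finsetSum _ (fun j _ => ia j), ← integral_finsetSum _ (fun j _ => ib j)]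
  congr 1; funext u
  have := hk.null (v - u) i
  simp only [Fin.sum_univ_three, PiLp.sub_apply] at *
  linear_combination mu0 u * this

theorem KH.div_bd (hk : KH ker n) :
    ∃ C : ℝ, 0 ≤ C ∧ ∀ v, |∑ i, pd i (fun w => ∑ j, sg ker w i j * w j) v| * jap v ^ n ≤ C := by
  have hs : ∀ j, Sm (fun u : V3 => u j * mu0 u) := fun j => (PS.coord j).mul_sm mu0_sm
  have h0 : ∀ i j, ∫ u, pd i (fun u : V3 => u j * mu0 u) u = 0 := fun i j => by
    have := ibp (PS.const 1) (hs j) i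
    simpa [pd_const] using this
  choose C hC using fun i j => hk.cv_zero_mean i j ((hs j).pd i) (h0 i j)
  have key : ∀ v, |∑ i, pd i (fun w => ∑ j, sg ker w i j * w j) v| * jap v ^ n ≤ ∑ i, ∑ j, C i j := by
    intro v
    have e : ∀ i, pd i (fun w => ∑ j, sg ker w i j * w j) v =
        ∑ j, cv (fun z => ker z i j) (pd i (fun u : V3 => u j * mu0 u)) v := by
      intro i
      simp_rw [hk.sgi i]
      rw [pd_sum _ (fun j => ((hk.sk i j).cv_ps (hs j)).1)]
      exact Finset.sum_congr rfl fun j _ => (hk.sk i j).pd_cv (hs j) i v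
    simp_rw [e]
    have hj := jap_pos v
    calc _ ≤ (∑ i, ∑ j, |cv (fun z => ker z i j) (pd i (fun u : V3 => u j * mu0 u)) v|) * jap v ^ n := by
          gcongr
          refine (Finset.abs_sum_le_sum_abs _ _).trans (Finset.sum_le_sum fun i _ => ?_)
          exact Finset.abs_sum_le_sum_abs _ _
      _ = ∑ i, ∑ j, |cv (fun z => ker z i j) (pd i (fun u : V3 => u j * mu0 u)) v| * jap v ^ n := by
          simp only [Finset.sum_mul]
      _ ≤ _ := Finset.sum_le_sum fun i _ => Finset.sum_le_sum fun j _ => hC i j v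
  exact ⟨_, le_trans (by have := jap_pos 0; positivity) (key 0), key⟩

end

section
variable {ker : V3 → Fin 3 → Fin 3 → ℝ} {n : ℕ}

/-- `∂_j g + v_j g / 2` -/
def hh (g : V3 → ℝ) (j : Fin 3) (v : V3) : ℝ := pd j g v + v j / 2 * g v

/-- nonlocal term -/
def Nn (ker : V3 → Fin 3 → Fin 3 → ℝ) (g : V3 → ℝ) (i : Fin 3) (v : V3) : ℝ :=
  ∑ j, cv (fun z => ker z i j) (fun u => sqmu u * hh g j u) v

/-- flux -/
def Xx (ker : V3 → Fin 3 → Fin 3 → ℝ) (g : V3 → ℝ) (i : Fin 3) (v : V3) : ℝ :=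
  ∑ j, sg ker v i j * hh g j v - sqmu v * Nn ker g i v

theorem hh_sm (g : SchwartzMap V3 ℝ) (j : Fin 3) : Sm (hh g j) := by
  have := (schwartz_pd g j).add (((PS.coord j).mul (PS.const 2⁻¹)).mul_sm (schwartz_sm g))
  exact this

theorem KH.Nn_ps (hk : KH ker n) (g : SchwartzMap V3 ℝ) (i : Fin 3) : PS (Nn ker g i) :=
  PS.sum _ fun j => (hk.sk i j).cv_ps (sqmu_sm.mul (hh_sm g j).ps)

theorem KH.Xx_ps (hk : KH ker n) (g : SchwartzMap V3 ℝ) (i : Fin 3) : PS (Xx ker g i) :=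
  (PS.sum _ fun j => (hk.sg_ps i j).mul (hh_sm g j).ps).sub (sqmu_sm.ps.mul (hk.Nn_ps g i))

theorem pd_sqmu_mul (g : SchwartzMap V3 ℝ) (j : Fin 3) (v : V3) :
    pd j (fun w => sqmu w * g w) v = sqmu v * (hh g j v - v j * g v) := by
  rw [pd_mul sqmu_sm.1 (schwartz_sm g).1, pd_sqmu]; unfold hh; ring

theorem KH.flux1 (hk : KH ker n) (g : SchwartzMap V3 ℝ) (i : Fin 3) (w : V3) :
    (∫ u : V3, ∑ j, ker (w - u) i j * (mu0 u * pd j (fun w => sqmu w * g w) w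
      - (sqmu w * g w) * pd j mu0 u)) = sqmu w * ∑ j, sg ker w i j * hh g j w := by
  have ia : ∀ j, Integrable (fun u => ker (w - u) i j * mu0 u * (sqmu w * hh g j w)) := fun j =>
    ((hk.sk i j).integrable mu0_sm.2.1 w).mul_const _
  have e : ∀ u : V3, ∑ j, ker (w - u) i j * (mu0 u * pd j (fun w => sqmu w * g w) w
      - (sqmu w * g w) * pd j mu0 u) = ∑ j, ker (w - u) i j * mu0 u * (sqmu w * hh g j w) := by
    intro u
    have := hk.null (w - u) i
    simp only [pd_sqmu_mul, pd_mu0, Fin.sum_univ_three, PiLp.sub_apply] at *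
    linear_combination (- mu0 u * sqmu w * g w) * this
  simp_rw [e]
  rw [integral_finsetSum _ (fun j _ => ia j), Finset.mul_sum]
  simp_rw [integral_mul_const]
  refine Finset.sum_congr rfl fun j _ => ?_
  unfold sg; ring

theorem KH.flux2 (hk : KH ker n) (g : SchwartzMap V3 ℝ) (i : Fin 3) (w : V3) :
    (∫ u : V3, ∑ j, ker (w - u) i j * ((sqmu u * g u) * pd j mu0 w
      - mu0 w * pd j (fun w => sqmu w * g w) u)) = sqmu w * (-(sqmu w * Nn ker g i w)) := by
  have ia : ∀ j, Integrable (fun u => (- mu0 w) * (ker (w - u) i j * (sqmu u * hh g j u))) := fun j =>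
    ((hk.sk i j).integrable (sqmu_sm.mul (hh_sm g j).ps).2.1 w).const_mul _
  have e : ∀ u : V3, ∑ j, ker (w - u) i j * ((sqmu u * g u) * pd j mu0 w
      - mu0 w * pd j (fun w => sqmu w * g w) u) =
      ∑ j, (- mu0 w) * (ker (w - u) i j * (sqmu u * hh g j u)) := by
    intro u
    have := hk.null (w - u) i
    simp only [pd_sqmu_mul, pd_mu0, Fin.sum_univ_three, PiLp.sub_apply] at *
    linear_combination (- mu0 w * sqmu u * g u) * this
  simp_rw [e]
  rw [integral_finsetSum _ (fun j _ => ia j)]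
  simp_rw [integral_const_mul]
  rw [← Finset.mul_sum, ← sqmu_sq]
  unfold Nn cv; ring

/-- generic linearized operator -/
def Lg (ker : V3 → Fin 3 → Fin 3 → ℝ) (g : V3 → ℝ) (v : V3) : ℝ :=
  -(sqmu v)⁻¹ * (landauQ ker mu0 (fun w => sqmu w * g w) v
    + landauQ ker (fun w => sqmu w * g w) mu0 v)

theorem KH.Lg_eq (hk : KH ker n) (g : SchwartzMap V3 ℝ) (v : V3) :
    Lg ker g v = ∑ i, (v i / 2 * Xx ker g i v - pd i (Xx ker g i) v) := by
  have h1 : landauQ ker mu0 (fun w => sqmu w * g w) v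
    + landauQ ker (fun w => sqmu w * g w) mu0 v = ∑ i, pd i (fun w => sqmu w * Xx ker g i w) v := by
    unfold landauQ
    rw [← Finset.sum_add_distrib]
    refine Finset.sum_congr rfl fun i _ => ?_
    simp_rw [hk.flux1 g i, hk.flux2 g i]
    rw [← pd_add]
    · congr 1; funext w; unfold Xx; ring
    · exact (sqmu_sm.ps.mul (PS.sum _ fun j => (hk.sg_ps i j).mul (hh_sm g j).ps)).1
    · exact (sqmu_sm.ps.mul (sqmu_sm.ps.mul (hk.Nn_ps g i)).neg).1
  unfold Lg
  rw [h1, Finset.mul_sum]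
  refine Finset.sum_congr rfl fun i _ => ?_
  rw [pd_mul sqmu_sm.1 (hk.Xx_ps g i).1, pd_sqmu]
  have := sqmu_pos v
  field_simp; ring

theorem KH.Lg_pg (hk : KH ker n) (g : SchwartzMap V3 ℝ) : Pg (Lg ker g) := by
  rw [show Lg ker g = _ from funext (hk.Lg_eq g)]
  refine Pg.sum _ fun i => Pg.sub ?_ ((hk.Xx_ps g i).pd i)
  exact ((Pg.coord i).mul (Pg.const 2⁻¹)).mul (hk.Xx_ps g i).2.1

/-- weak form -/
theorem KH.weak (hk : KH ker n) (g : SchwartzMap V3 ℝ) (p : ℝ) :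
    ∫ v, jap v ^ p * (Lg ker g v * g v) =
      ∫ v, jap v ^ p * ∑ i, (hh g i v + p * (jap v ^ 2)⁻¹ * v i * g v) * Xx ker g i v := by
  have hg := schwartz_sm g
  have hW := jap_ps p
  have hWg : Sm (fun v => jap v ^ p * g v) := hW.mul_sm hg
  have ia : ∀ i, Integrable (fun v => jap v ^ p * g v * (v i / 2 * Xx ker g i v)) := fun i =>
    (hWg.2.1.mul_pg (((Pg.coord i).mul (Pg.const 2⁻¹)).mul (hk.Xx_ps g i).2.1)).integrable
  have ib : ∀ i, Integrable (fun v => jap v ^ p * g v * pd i (Xx ker g i) v) := fun i =>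
    (hWg.2.1.mul_pg ((hk.Xx_ps g i).pd i)).integrable
  have ic : ∀ i, Integrable (fun v => Xx ker g i v * pd i (fun v => jap v ^ p * g v) v) := fun i =>
    ((hk.Xx_ps g i).2.1.mul_rd (hWg.pd i)).integrable
  have key : ∀ i, ∫ v, jap v ^ p * g v * pd i (Xx ker g i) v =
      - ∫ v, Xx ker g i v * pd i (fun v => jap v ^ p * g v) v := fun i => by
    rw [ibp (hk.Xx_ps g i) hWg i, neg_neg]
    congr 1; funext v; ring
  have e1 : ∀ v, jap v ^ p * (Lg ker g v * g v) = ∑ i, (jap v ^ p * g v * (v i / 2 * Xx ker g i v)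
      - jap v ^ p * g v * pd i (Xx ker g i) v) := fun v => by
    rw [hk.Lg_eq, Finset.sum_mul, Finset.mul_sum]
    exact Finset.sum_congr rfl fun i _ => by ring
  have e2 : ∀ v, jap v ^ p * ∑ i, (hh g i v + p * (jap v ^ 2)⁻¹ * v i * g v) * Xx ker g i v =
      ∑ i, (jap v ^ p * g v * (v i / 2 * Xx ker g i v)
        + Xx ker g i v * pd i (fun v => jap v ^ p * g v) v) := fun v => by
    rw [Finset.mul_sum]
    refine Finset.sum_congr rfl fun i _ => ?_
    rw [pd_mul hW.1 hg.1, pd_jap, Real.rpow_sub (jap_pos v)]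
    unfold hh
    norm_num
    ring
  simp_rw [e1, e2]
  have iab : ∀ i, Integrable (fun v => jap v ^ p * g v * (v i / 2 * Xx ker g i v)
      - jap v ^ p * g v * pd i (Xx ker g i) v) := fun i => (ia i).sub (ib i)
  have iac : ∀ i, Integrable (fun v => jap v ^ p * g v * (v i / 2 * Xx ker g i v)
      + Xx ker g i v * pd i (fun v => jap v ^ p * g v) v) := fun i => (ia i).add (ic i)
  rw [integral_finsetSum _ (fun i _ => iab i), integral_finsetSum _ (fun i _ => iac i)]
  refine Finset.sum_congr rfl fun i _ => ?_
  rw [integral_sub (ia i) (ib i), integral_add (ia i) (ic i), key]; ring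

theorem wcs {k f ρ : V3 → ℝ} (hρ : ∀ u, 0 ≤ ρ u) (h1 : Integrable (fun u => k u ^ 2 * ρ u))
    (h2 : Integrable (fun u => f u ^ 2 * ρ u)) (h3 : Integrable (fun u => k u * (ρ u * f u))) :
    (∫ u, k u * (ρ u * f u)) ^ 2 ≤ (∫ u, k u ^ 2 * ρ u) * ∫ u, f u ^ 2 * ρ u := by
  have : ∀ x : ℝ, 0 ≤ (∫ u, k u ^ 2 * ρ u) * (x * x) + (2 * ∫ u, k u * (ρ u * f u)) * x
      + ∫ u, f u ^ 2 * ρ u := fun x => by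
    have e : (∫ u, k u ^ 2 * ρ u) * (x * x) + (2 * ∫ u, k u * (ρ u * f u)) * x
      + ∫ u, f u ^ 2 * ρ u = ∫ u, (k u * x + f u) ^ 2 * ρ u := by
      have i1 := h1.mul_const (x * x)
      have i2 := (h3.const_mul 2).mul_const x
      have i12 : Integrable (fun u => k u ^ 2 * ρ u * (x * x) + 2 * (k u * (ρ u * f u)) * x) := i1.add i2
      rw [← integral_const_mul, ← integral_mul_const, ← integral_mul_const, ← integral_add i1 i2,
        ← integral_add i12 h2]
      congr 1; funext u; ring
    rw [e]
    exact integral_nonneg fun u => mul_nonneg (sq_nonneg _) (hρ u)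
  have := discrim_le_zero this
  unfold discrim at this
  nlinarith

theorem KH.Nn_bd (hk : KH ker n) : ∃ P : V3 → ℝ, Pg P ∧ (∀ v, 0 ≤ P v) ∧
    ∀ (g : SchwartzMap V3 ℝ) (i : Fin 3) (v : V3), Nn ker g i v ^ 2 ≤
      P v * ∑ j, ∫ u, hh g j u ^ 2 * sqmu u := by
  refine ⟨fun v => 3 * ∑ i, ∑ j, cv (fun z => ker z i j ^ 2) sqmu v, ?_, ?_, fun g i v => ?_⟩
  · exact (Pg.const 3).mul (Pg.sum _ fun i => Pg.sum _ fun j => (hk.sk2 i j).cv_pg sqmu_sm.2.1)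
  · intro v
    have : ∀ i j, 0 ≤ cv (fun z => ker z i j ^ 2) sqmu v := fun i j =>
      integral_nonneg fun u => mul_nonneg (sq_nonneg _) (sqmu_pos u).le
    have := Finset.sum_nonneg fun i (_ : i ∈ Finset.univ) =>
      Finset.sum_nonneg fun j (_ : j ∈ Finset.univ) => this i j
    linarith
  · have h0 : ∀ i j, 0 ≤ cv (fun z => ker z i j ^ 2) sqmu v := fun i j =>
      integral_nonneg fun u => mul_nonneg (sq_nonneg _) (sqmu_pos u).le
    have hH : ∀ j, 0 ≤ ∫ u, hh g j u ^ 2 * sqmu u := fun j =>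
      integral_nonneg fun u => mul_nonneg (sq_nonneg _) (sqmu_pos u).le
    have hcs : ∀ j, cv (fun z => ker z i j) (fun u => sqmu u * hh g j u) v ^ 2 ≤
        (∑ i, ∑ j, cv (fun z => ker z i j ^ 2) sqmu v) * ∫ u, hh g j u ^ 2 * sqmu u := fun j => by
      have := wcs (k := fun u => ker (v - u) i j) (f := hh g j) (ρ := sqmu) (fun u => (sqmu_pos u).le)
        ((hk.sk2 i j).integrable sqmu_sm.2.1 v)
        (((hh_sm g j).2.1.sq.mul_pg sqmu_sm.2.1.pg).integrable)
        ((hk.sk i j).integrable (sqmu_sm.mul (hh_sm g j).ps).2.1 v)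
      refine this.trans (mul_le_mul_of_nonneg_right ?_ (hH j))
      refine le_trans ?_ (Finset.single_le_sum (f := fun i => ∑ j, cv (fun z => ker z i j ^ 2) sqmu v)
        (fun i _ => Finset.sum_nonneg fun j _ => h0 i j) (Finset.mem_univ i))
      exact (Finset.single_le_sum (f := fun j => cv (fun z => ker z i j ^ 2) sqmu v)
        (fun j _ => h0 i j) (Finset.mem_univ j))
    unfold Nn
    refine (sq_sum_le_card_mul_sum_sq).trans ?_
    simp only [Finset.card_univ, Fintype.card_fin]
    calc _ ≤ ((3:ℕ):ℝ) * ∑ j, (∑ i, ∑ j, cv (fun z => ker z i j ^ 2) sqmu v) * ∫ u, hh g j u ^ 2 * sqmu u := by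
          gcongr with j _; exact hcs j
      _ = _ := by rw [← Finset.mul_sum]; push_cast; ring

end

section
variable {ker : V3 → Fin 3 → Fin 3 → ℝ} {n : ℕ}

/-- isotropic energy density -/
def Dd (g : V3 → ℝ) (v : V3) : ℝ := ∑ i, (pd i g v ^ 2 + v i ^ 2 * g v ^ 2)

/-- anisotropic energy density -/
def Ee (ker : V3 → Fin 3 → Fin 3 → ℝ) (g : V3 → ℝ) (v : V3) : ℝ :=
  ∑ i, ∑ j, sg ker v i j * (pd i g v * pd j g v + v i * v j * (g v) ^ 2)

theorem nsq3 (v : V3) : ‖v‖ ^ 2 = ∑ i, v i ^ 2 := by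
  rw [EuclideanSpace.norm_sq_eq]; simp

theorem Dd_nonneg (g : V3 → ℝ) (v : V3) : 0 ≤ Dd g v :=
  Finset.sum_nonneg fun i _ => by positivity

theorem Dd_rd (g : SchwartzMap V3 ℝ) : Rd (Dd g) :=
  Rd.sum _ fun i => ((schwartz_pd g i).2.1.sq).add
    (((Pg.coord i).pow 2).mul_rd (schwartz_sm g).2.1.sq)

theorem KH.Ee_rd (hk : KH ker n) (g : SchwartzMap V3 ℝ) : Rd (Ee ker g) :=
  Rd.sum _ fun i => Rd.sum _ fun j => (hk.sg_ps i j).2.1.mul_rd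
    (((schwartz_pd g i).2.1.mul_pg (schwartz_pd g j).2.1.pg).add
      (((Pg.coord i).mul (Pg.coord j)).mul_rd (schwartz_sm g).2.1.sq))

theorem KH.E_low (hk : KH ker n) : ∃ c > 0, ∀ (g : V3 → ℝ) v,
    c * (jap v ^ (n + 1))⁻¹ * Dd g v ≤ Ee ker g v := by
  obtain ⟨c, hc, h⟩ := hk.sg_low
  refine ⟨c, hc, fun g v => ?_⟩
  have h1 := h v (fun i => pd i g v)
  have h2 := h v (fun i => v i * g v)
  have e1 : Dd g v = ∑ i, pd i g v ^ 2 + ∑ i, (v i * g v) ^ 2 := by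
    unfold Dd; simp only [Fin.sum_univ_three]; ring
  have e2 : Ee ker g v = ∑ i, ∑ j, sg ker v i j * (pd i g v * pd j g v)
      + ∑ i, ∑ j, sg ker v i j * (v i * g v * (v j * g v)) := by
    unfold Ee; simp only [Fin.sum_univ_three]; ring
  rw [e1, e2, mul_add]
  exact add_le_add h1 h2

theorem KH.Ee_nonneg (hk : KH ker n) (g : V3 → ℝ) (v : V3) : 0 ≤ Ee ker g v := by
  obtain ⟨c, hc, h⟩ := hk.E_low
  refine le_trans ?_ (h g v)
  have := jap_pos v
  have := Dd_nonneg g v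
  positivity

theorem KH.D_int (hk : KH ker n) : ∃ K, 0 ≤ K ∧ ∀ (p : ℝ) (g : SchwartzMap V3 ℝ),
    ∫ v, jap v ^ (p - n - 2) * Dd g v ≤ K * ∫ v, jap v ^ (p - 1) * Ee ker g v := by
  obtain ⟨c, hc, h⟩ := hk.E_low
  refine ⟨c⁻¹, by positivity, fun p g => ?_⟩
  rw [← integral_const_mul]
  refine integral_mono ((jap_pg _).mul_rd (Dd_rd g)).integrable
    ((((jap_pg _).mul_rd (hk.Ee_rd g)).integrable).const_mul _) fun v => ?_
  have hj := jap_pos v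
  have e : jap v ^ (p - n - 2) = jap v ^ (p - 1) * (jap v ^ (n + 1))⁻¹ := by
    rw [← Real.rpow_natCast, ← Real.rpow_neg hj.le, ← Real.rpow_add hj]
    congr 1; push_cast; ring
  have h3 : jap v ^ (p - 1) * (c * (jap v ^ (n + 1))⁻¹ * Dd g v) ≤ jap v ^ (p - 1) * Ee ker g v :=
    mul_le_mul_of_nonneg_left (h g v) (by positivity)
  have h4 := mul_le_mul_of_nonneg_left h3 (inv_nonneg.2 hc.le)
  refine le_trans (le_of_eq ?_) h4
  dsimp only
  rw [e]; field_simp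

theorem hardy (m : ℝ) (g : SchwartzMap V3 ℝ) :
    3 * ∫ v, jap v ^ m * g v ^ 2 ≤ (|m| + 1) * ∫ v, jap v ^ m * Dd g v := by
  have hg := schwartz_sm g
  have hg2 : Sm (fun v => g v * g v) := hg.mul hg.ps
  have hp : ∀ i v, pd i (fun v => g v * g v) v = 2 * (g v * pd i g v) := fun i v => by
    rw [pd_mul hg.1 hg.1]; ring
  have ha : ∀ i, PS (fun v : V3 => jap v ^ m * v i) := fun i => (jap_ps m).mul (PS.coord i)
  have hpa : ∀ i v, pd i (fun v : V3 => jap v ^ m * v i) v =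
      m * jap v ^ (m - 2) * v i ^ 2 + jap v ^ m := fun i v => by
    rw [pd_mul (jap_ps m).1 (PS.coord i).1, pd_jap, pd_coord]; simp; ring
  have key : ∀ i, 0 = ∫ v, (jap v ^ m * v i * (2 * (g v * pd i g v))
      + (m * jap v ^ (m - 2) * v i ^ 2 + jap v ^ m) * (g v * g v)) := fun i => by
    have h := ibp (ha i) hg2 i
    have i1 := ((ha i).2.1.mul_rd (hg2.pd i)).integrable
    have i2 := (((ha i).pd i).mul_rd hg2.2.1).integrable
    simp_rw [hp, hpa] at h i1 i2
    rw [integral_add i1 i2, h]; ring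
  have ik : ∀ i, Integrable (fun v => (jap v ^ m * v i * (2 * (g v * pd i g v))
      + (m * jap v ^ (m - 2) * v i ^ 2 + jap v ^ m) * (g v * g v))) := fun i => by
    have i1 := ((ha i).2.1.mul_rd (hg2.pd i)).integrable
    have i2 := (((ha i).pd i).mul_rd hg2.2.1).integrable
    simp_rw [hp, hpa] at i1 i2
    exact i1.add i2
  have ks : 0 = ∫ v, ∑ i, (jap v ^ m * v i * (2 * (g v * pd i g v))
      + (m * jap v ^ (m - 2) * v i ^ 2 + jap v ^ m) * (g v * g v)) := by
    rw [integral_finsetSum _ (fun i _ => ik i)]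
    simp [← key]
  have iD := ((jap_pg m).mul_rd (Dd_rd g)).integrable
  have ig := ((jap_pg m).mul_rd hg.2.1.sq).integrable
  have iks : Integrable (fun v => ∑ i, (jap v ^ m * v i * (2 * (g v * pd i g v))
      + (m * jap v ^ (m - 2) * v i ^ 2 + jap v ^ m) * (g v * g v))) :=
    integrable_finsetSum _ (fun i _ => ik i)
  rw [← add_zero ((|m| + 1) * _), ks, ← integral_const_mul, ← integral_const_mul,
    ← integral_add (iD.const_mul _) iks]
  refine integral_mono (ig.const_mul _) ((iD.const_mul _).add iks) fun v => ?_
  have hj := jap_pos v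
  have h1 := one_le_jap v
  have e : jap v ^ (m - 2) = jap v ^ m * (jap v ^ 2)⁻¹ := by
    rw [Real.rpow_sub hj]; norm_num; rfl
  have hJ : (jap v ^ 2)⁻¹ ≤ 1 := inv_le_one_of_one_le₀ (by nlinarith)
  have hJ0 : 0 ≤ (jap v ^ 2)⁻¹ := by positivity
  have hm1 : -(|m|) ≤ m * (jap v ^ 2)⁻¹ := by
    have := neg_abs_le m
    have h0 := abs_nonneg m
    nlinarith
  have key2 : ∀ i, 0 ≤ (|m| + 1) * (pd i g v ^ 2 + v i ^ 2 * g v ^ 2) + 2 * v i * g v * pd i g v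
      + m * (jap v ^ 2)⁻¹ * v i ^ 2 * g v ^ 2 := fun i => by
    have a1 : 0 ≤ (m * (jap v ^ 2)⁻¹ + |m|) * (v i ^ 2 * g v ^ 2) :=
      mul_nonneg (by linarith) (by positivity)
    have a2 : 0 ≤ |m| * pd i g v ^ 2 := by positivity
    nlinarith [sq_nonneg (pd i g v + v i * g v)]
  have key3 := mul_nonneg (Real.rpow_pos_of_pos hj m).le
    (Finset.sum_nonneg fun i (_ : i ∈ Finset.univ) => key2 i)
  dsimp only
  rw [e]
  unfold Dd
  simp only [Fin.sum_univ_three] at *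
  linarith

theorem zord (p : ℝ) (n : ℕ) (g : SchwartzMap V3 ℝ) :
    ∫ v, jap v ^ (p - n) * g v ^ 2 ≤ (|p - n - 2| + 2) * ∫ v, jap v ^ (p - n - 2) * Dd g v := by
  set m := p - n - 2 with hm
  have hg := schwartz_sm g
  have h := hardy m g
  have iD := ((jap_pg m).mul_rd (Dd_rd g)).integrable
  have ig := ((jap_pg m).mul_rd hg.2.1.sq).integrable
  have ig2 := ((jap_pg (p - n)).mul_rd hg.2.1.sq).integrable
  have hD0 : 0 ≤ ∫ v, jap v ^ m * Dd g v := integral_nonneg fun v =>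
    mul_nonneg (Real.rpow_pos_of_pos (jap_pos v) m).le (Dd_nonneg g v)
  have hle : ∫ v, jap v ^ (p - n) * g v ^ 2 ≤ ∫ v, (jap v ^ m * g v ^ 2 + jap v ^ m * Dd g v) := by
    refine integral_mono ig2 (ig.add iD) fun v => ?_
    have hj := jap_pos v
    have e : jap v ^ (p - n) = jap v ^ m * (1 + ‖v‖ ^ 2) := by
      rw [← jap_sq, ← Real.rpow_natCast, ← Real.rpow_add hj]; congr 1; rw [hm]; push_cast; ring
    have : ‖v‖ ^ 2 * g v ^ 2 ≤ Dd g v := by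
      rw [nsq3]; unfold Dd
      rw [Finset.sum_mul]
      exact Finset.sum_le_sum fun i _ => by nlinarith [sq_nonneg (pd i g v)]
    have := mul_le_mul_of_nonneg_left this (Real.rpow_pos_of_pos hj m).le
    dsimp only
    rw [e]; linarith
  rw [integral_add ig iD] at hle
  have : 0 ≤ |m| * ∫ v, jap v ^ m * Dd g v := mul_nonneg (abs_nonneg _) hD0
  linarith

theorem sqmu_bd {P : V3 → ℝ} (hP : Pg P) (m : ℝ) :
    ∃ K, 0 ≤ K ∧ ∀ v, P v * sqmu v ≤ K * jap v ^ m := by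
  obtain ⟨C, hC⟩ := ((hP.mul (jap_pg (-m))).mul_rd sqmu_sm.2.1).2 0
  simp only [pow_zero, mul_one] at hC
  refine ⟨C, (abs_nonneg _).trans (hC 0), fun v => ?_⟩
  have hj := Real.rpow_pos_of_pos (jap_pos v) m
  have := (le_abs_self _).trans (hC v)
  rw [Real.rpow_neg (jap_pos v).le] at this
  have := mul_le_mul_of_nonneg_right this hj.le
  refine le_trans (le_of_eq ?_) this
  field_simp

theorem KH.cross (hk : KH ker n) (p : ℝ) (g : SchwartzMap V3 ℝ) :
    ∫ v, jap v ^ p * (g v * ∑ i, ∑ j, sg ker v i j * (pd i g v * v j)) =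
      - ∫ v, (1 / 2 * (jap v ^ p * (p * (jap v ^ 2)⁻¹) * (∑ i, ∑ j, sg ker v i j * (v i * v j)) * g v ^ 2)
        + 1 / 2 * (jap v ^ p * (∑ i, pd i (fun w => ∑ j, sg ker w i j * w j) v) * g v ^ 2)) := by
  have hg := schwartz_sm g
  have hg2 : Sm (fun v => g v * g v) := hg.mul hg.ps
  have hp : ∀ i v, pd i (fun v => g v * g v) v = 2 * (g v * pd i g v) := fun i v => by
    rw [pd_mul hg.1 hg.1]; ring
  have hs : ∀ i, PS (fun v : V3 => ∑ j, sg ker v i j * v j) := fun i =>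
    PS.sum _ fun j => (hk.sg_ps i j).mul (PS.coord j)
  have ha : ∀ i, PS (fun v : V3 => jap v ^ p * ∑ j, sg ker v i j * v j) := fun i =>
    (jap_ps p).mul (hs i)
  have hpa : ∀ i v, pd i (fun v : V3 => jap v ^ p * ∑ j, sg ker v i j * v j) v =
      p * jap v ^ (p - 2) * v i * (∑ j, sg ker v i j * v j)
        + jap v ^ p * pd i (fun w => ∑ j, sg ker w i j * w j) v := fun i v => by
    rw [pd_mul (jap_ps p).1 (hs i).1, pd_jap]
  have i1 := fun i => ((ha i).2.1.mul_rd (hg2.pd i)).integrable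
  have i2 := fun i => (((ha i).pd i).mul_rd hg2.2.1).integrable
  have key : ∑ i, ∫ v, (jap v ^ p * ∑ j, sg ker v i j * v j) * pd i (fun v => g v * g v) v =
     ∑ i, - ∫ v, pd i (fun v : V3 => jap v ^ p * ∑ j, sg ker v i j * v j) v * (g v * g v) :=
    Finset.sum_congr rfl fun i _ => ibp (ha i) hg2 i
  rw [Finset.sum_neg_distrib, ← integral_finsetSum _ (fun i _ => i1 i),
    ← integral_finsetSum _ (fun i _ => i2 i)] at key
  have key' := congrArg (fun x => (1/2 : ℝ) * x) key
  simp only [mul_neg, ← integral_const_mul] at key'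
  refine Eq.trans ?_ (key'.trans ?_)
  · congr 1; funext v
    simp_rw [hp]
    simp only [Fin.sum_univ_three]; ring
  · congr 2; funext v
    simp_rw [hpa]
    have e : jap v ^ (p - 2) = jap v ^ p * (jap v ^ 2)⁻¹ := by
      rw [Real.rpow_sub (jap_pos v)]; norm_num; rfl
    rw [e]
    simp only [Fin.sum_univ_three]; ring

end

section
variable {ker : V3 → Fin 3 → Fin 3 → ℝ} {n : ℕ}

theorem quad_alg (s : Fin 3 → Fin 3 → ℝ) (a : Fin 3 → ℝ) (v : V3) (x r d : ℝ)
    (hs : ∀ i j, s i j = s j i) (hr : 0 ≤ r)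
    (hq1 : 0 ≤ ∑ i, ∑ j, s i j * ((a i + v i * x) * (a j + v j * x)))
    (hq2 : 0 ≤ ∑ i, ∑ j, s i j * (a i * a j)) :
    1 / 4 * (∑ i, ∑ j, s i j * (a i * a j + v i * v j * x ^ 2))
      - r / 2 * (∑ i, ∑ j, s i j * (a i * a j + v i * v j * x ^ 2)) - 1 / 2 * d * x ^ 2 ≤
      (∑ i, (a i + v i / 2 * x + r * v i * x) * ∑ j, s i j * (a j + v j / 2 * x))
        - x * (∑ i, ∑ j, s i j * (a i * v j))
        - 1 / 2 * (r * (∑ i, ∑ j, s i j * (v i * v j)) * x ^ 2) - 1 / 2 * d * x ^ 2 := by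
  have hq1' := mul_nonneg (by positivity : 0 ≤ r / 2) hq1
  rw [← sub_nonneg]
  refine le_trans (add_nonneg hq1' (mul_nonneg (by norm_num : (0:ℝ) ≤ 3 / 4) hq2)) (le_of_eq ?_)
  simp only [Fin.sum_univ_three, hs 1 0, hs 2 0, hs 2 1]
  ring

set_option maxHeartbeats 1000000 in
theorem KH.Apart (hk : KH ker n) {p : ℝ} (hp : 0 ≤ p) : ∃ C, 0 ≤ C ∧ ∀ g : SchwartzMap V3 ℝ,
    1 / 4 * (∫ v, jap v ^ p * Ee ker g v) - C * (∫ v, jap v ^ (p - 1) * Ee ker g v) ≤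
      ∫ v, jap v ^ p * ∑ i, (hh g i v + p * (jap v ^ 2)⁻¹ * v i * g v) * ∑ j, sg ker v i j * hh g j v := by
  obtain ⟨C, hC, hdiv⟩ := hk.div_bd
  obtain ⟨K, hK, hD⟩ := hk.D_int
  refine ⟨p / 2 + 1 / 2 * C * ((|p - n - 2| + 2) * K), by positivity, fun g => ?_⟩
  have hg := schwartz_sm g
  have hz := zord p n g
  have hcr := hk.cross p g
  have hDg := hD p g
  have sgp := fun i j => (hk.sg_ps i j).2.1
  have hJ2 : Pg (fun v => (jap v ^ 2)⁻¹) := by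
    have := jap_pg (-2)
    refine Pg.mono ?_ this fun v => ?_
    · unfold jap; fun_prop
    · rw [Real.rpow_neg (jap_pos v).le]; norm_num
  have rS : Rd (fun v => g v * ∑ i, ∑ j, sg ker v i j * (pd i g v * v j)) :=
    hg.2.1.mul_pg (Pg.sum _ fun i => Pg.sum _ fun j => (sgp i j).mul
      ((hg.pd i).pg.mul (Pg.coord j)))
  have pQ2 : Pg (fun v => ∑ i, ∑ j, sg ker v i j * (v i * v j)) :=
    Pg.sum _ fun i => Pg.sum _ fun j => (sgp i j).mul ((Pg.coord i).mul (Pg.coord j))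
  have pdiv : Pg (fun v => ∑ i, pd i (fun w => ∑ j, sg ker w i j * w j) v) :=
    Pg.sum _ fun i => (PS.sum _ fun j => (hk.sg_ps i j).mul (PS.coord j)).pd i
  have i1 := ((jap_pg p).mul_rd rS).integrable
  have i2 : Integrable (fun v => (1 / 2 * (jap v ^ p * (p * (jap v ^ 2)⁻¹) *
      (∑ i, ∑ j, sg ker v i j * (v i * v j)) * g v ^ 2)
        + 1 / 2 * (jap v ^ p * (∑ i, pd i (fun w => ∑ j, sg ker w i j * w j) v) * g v ^ 2))) :=
    ((((((jap_pg p).mul ((Pg.const p).mul hJ2)).mul pQ2).mul_rd hg.2.1.sq).integrable).const_mul _).add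
      (((((jap_pg p).mul pdiv).mul_rd hg.2.1.sq).integrable).const_mul _)
  have i3 : Integrable (fun v => jap v ^ p * ∑ i, (hh g i v + p * (jap v ^ 2)⁻¹ * v i * g v) *
      ∑ j, sg ker v i j * hh g j v) := by
    refine ((jap_pg p).mul_rd (Rd.sum _ fun i => ?_)).integrable
    exact ((hh_sm g i).2.1.add ((((Pg.const p).mul hJ2).mul (Pg.coord i)).mul_rd hg.2.1)).mul_pg
      (Pg.sum _ fun j => (sgp i j).mul (hh_sm g j).2.1.pg)
  have iE := ((jap_pg p).mul_rd (hk.Ee_rd g)).integrable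
  have iE1 := ((jap_pg (p - 1)).mul_rd (hk.Ee_rd g)).integrable
  have ig := ((jap_pg (p - n)).mul_rd hg.2.1.sq).integrable
  have e : ∫ v, jap v ^ p * ∑ i, (hh g i v + p * (jap v ^ 2)⁻¹ * v i * g v) *
      ∑ j, sg ker v i j * hh g j v =
      ∫ v, (jap v ^ p * (∑ i, (hh g i v + p * (jap v ^ 2)⁻¹ * v i * g v) *
        ∑ j, sg ker v i j * hh g j v) -
        jap v ^ p * (g v * ∑ i, ∑ j, sg ker v i j * (pd i g v * v j)) -
        (1 / 2 * (jap v ^ p * (p * (jap v ^ 2)⁻¹) *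
      (∑ i, ∑ j, sg ker v i j * (v i * v j)) * g v ^ 2)
        + 1 / 2 * (jap v ^ p * (∑ i, pd i (fun w => ∑ j, sg ker w i j * w j) v) * g v ^ 2))) := by
    have i31 : Integrable (fun v => jap v ^ p * (∑ i, (hh g i v + p * (jap v ^ 2)⁻¹ * v i * g v) *
        ∑ j, sg ker v i j * hh g j v) -
        jap v ^ p * (g v * ∑ i, ∑ j, sg ker v i j * (pd i g v * v j))) := i3.sub i1
    rw [integral_sub i31 i2, integral_sub i3 i1, hcr]; ring
  have low : ∫ v, (1 / 4 * (jap v ^ p * Ee ker g v) - p / 2 * (jap v ^ (p - 1) * Ee ker g v)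
      - 1 / 2 * C * (jap v ^ (p - n) * g v ^ 2)) ≤ ∫ v, jap v ^ p *
      ∑ i, (hh g i v + p * (jap v ^ 2)⁻¹ * v i * g v) * ∑ j, sg ker v i j * hh g j v := by
    rw [e]
    refine integral_mono (((iE.const_mul _).sub (iE1.const_mul _)).sub (ig.const_mul _))
      ((i3.sub i1).sub i2) fun v => ?_
    have hj := jap_pos v
    have hj1 := one_le_jap v
    have hW := Real.rpow_pos_of_pos hj p
    have ew1 : jap v ^ (p - 1) = jap v ^ p * (jap v)⁻¹ := by
      rw [Real.rpow_sub hj]; norm_num; rfl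
    have ewn : jap v ^ (p - n) = jap v ^ p * (jap v ^ n)⁻¹ := by
      rw [Real.rpow_sub hj, Real.rpow_natCast]; rfl
    have hE := hk.Ee_nonneg g v
    obtain ⟨c, hc, hlow⟩ := hk.sg_low
    have hq : ∀ ξ : Fin 3 → ℝ, 0 ≤ ∑ i, ∑ j, sg ker v i j * (ξ i * ξ j) := fun ξ =>
      le_trans (mul_nonneg (by positivity) (Finset.sum_nonneg fun i _ => sq_nonneg _)) (hlow v ξ)
    have hq1 := hq (fun i => pd i g v + v i * g v)
    have hq2 := hq (fun i => pd i g v)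
    set r := p * (jap v ^ 2)⁻¹ with hr
    set d := ∑ i, pd i (fun w => ∑ j, sg ker w i j * w j) v with hd
    have hr0 : 0 ≤ r := by positivity
    have hr1 : r ≤ p * (jap v)⁻¹ := mul_le_mul_of_nonneg_left
      (inv_anti₀ hj (by nlinarith)) hp
    have hd1 : d ≤ C * (jap v ^ n)⁻¹ := by
      rw [← div_eq_mul_inv, le_div_iff₀ (by positivity)]
      exact (mul_le_mul_of_nonneg_right (le_abs_self _) (by positivity)).trans (hdiv v)
    have main : 1 / 4 * Ee ker g v - r / 2 * Ee ker g v - 1 / 2 * d * g v ^ 2 ≤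
        (∑ i, (hh g i v + r * v i * g v) * ∑ j, sg ker v i j * hh g j v)
        - g v * (∑ i, ∑ j, sg ker v i j * (pd i g v * v j))
        - 1 / 2 * (r * (∑ i, ∑ j, sg ker v i j * (v i * v j)) * g v ^ 2) - 1 / 2 * d * g v ^ 2 := by
      exact quad_alg (sg ker v) (fun i => pd i g v) v (g v) r d (hk.sg_symm v) hr0 hq1 hq2
    have m1 : 0 ≤ jap v ^ p * ((p * (jap v)⁻¹ - r) * Ee ker g v) :=
      mul_nonneg hW.le (mul_nonneg (by linarith) hE)
    have m2 : 0 ≤ jap v ^ p * ((C * (jap v ^ n)⁻¹ - d) * g v ^ 2) :=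
      mul_nonneg hW.le (mul_nonneg (by linarith) (sq_nonneg _))
    have m3 := mul_le_mul_of_nonneg_left main hW.le
    dsimp only
    rw [ew1, ewn]
    linarith
  have iA : Integrable (fun v => 1 / 4 * (jap v ^ p * Ee ker g v)
      - p / 2 * (jap v ^ (p - 1) * Ee ker g v)) := (iE.const_mul _).sub (iE1.const_mul _)
  rw [integral_sub iA (ig.const_mul _), integral_sub (iE.const_mul _) (iE1.const_mul _),
    integral_const_mul, integral_const_mul, integral_const_mul] at low
  refine le_trans ?_ low
  have t1 := hz.trans (mul_le_mul_of_nonneg_left hDg (by positivity))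
  have t2 := mul_le_mul_of_nonneg_left t1 (by positivity : 0 ≤ 1 / 2 * C)
  linarith

theorem KH.Bpart (hk : KH ker n) {p : ℝ} (hp : 0 ≤ p) : ∃ C, 0 ≤ C ∧ ∀ g : SchwartzMap V3 ℝ,
    (∫ v, jap v ^ p * ∑ i, (hh g i v + p * (jap v ^ 2)⁻¹ * v i * g v) * (sqmu v * Nn ker g i v))
      ≤ C * (∫ v, jap v ^ (p - 1) * Ee ker g v) := by
  obtain ⟨P, hP, hP0, hN⟩ := hk.Nn_bd
  obtain ⟨K, hK, hD⟩ := hk.D_int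
  set m := p - n - 2 with hm
  obtain ⟨K1, hK1, hb1⟩ := sqmu_bd (jap_pg p) m
  obtain ⟨K3, hK3, hb3⟩ := sqmu_bd (Pg.const 1) m
  have iP := (((jap_pg p).mul hP).mul_rd sqmu_sm.2.1).integrable
  set K2 := ∫ v, jap v ^ p * P v * sqmu v with hK2
  have hK20 : 0 ≤ K2 := integral_nonneg fun v => mul_nonneg (mul_nonneg
    (Real.rpow_pos_of_pos (jap_pos v) p).le (hP0 v)) (sqmu_pos v).le
  refine ⟨(K1 * (1 + p) ^ 2 + 3 / 2 * K2 * (2 * K3)) * K, by positivity, fun g => ?_⟩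
  have hg := schwartz_sm g
  have hDg := hD p g
  rw [← hm] at hDg
  have iD := ((jap_pg m).mul_rd (Dd_rd g)).integrable
  have hJ2 : Pg (fun v => (jap v ^ 2)⁻¹) := by
    have := jap_pg (-2)
    refine Pg.mono ?_ this fun v => ?_
    · unfold jap; fun_prop
    · rw [Real.rpow_neg (jap_pos v).le]; norm_num
  set H := ∑ j, ∫ u, hh g j u ^ 2 * sqmu u with hH
  have ih : ∀ j, Integrable (fun u => hh g j u ^ 2 * sqmu u) := fun j =>
    ((hh_sm g j).2.1.sq.mul_pg sqmu_sm.2.1.pg).integrable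
  have H0 : 0 ≤ H := Finset.sum_nonneg fun j _ => integral_nonneg fun u =>
    mul_nonneg (sq_nonneg _) (sqmu_pos u).le
  have H1 : H ≤ 2 * K3 * ∫ v, jap v ^ m * Dd g v := by
    rw [hH, ← integral_finsetSum _ (fun j _ => ih j), ← integral_const_mul]
    refine integral_mono (integrable_finsetSum _ (fun j _ => ih j)) (iD.const_mul _) fun v => ?_
    dsimp only
    have h1 : ∑ j, hh g j v ^ 2 ≤ 2 * Dd g v := by
      unfold Dd hh; rw [Finset.mul_sum]
      refine Finset.sum_le_sum fun j _ => ?_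
      nlinarith [sq_nonneg (pd j g v - v j / 2 * g v), sq_nonneg (v j * g v)]
    rw [← Finset.sum_mul]
    have h2 := hb3 v
    have h3 := mul_le_mul_of_nonneg_right h1 (sqmu_pos v).le
    have h4 := mul_le_mul_of_nonneg_right h2 (Dd_nonneg g v)
    linarith
  have i0 : Integrable (fun v => jap v ^ p * ∑ i, (hh g i v + p * (jap v ^ 2)⁻¹ * v i * g v) *
      (sqmu v * Nn ker g i v)) := by
    refine ((jap_pg p).mul_rd (Rd.sum _ fun i => ?_)).integrable
    exact ((hh_sm g i).2.1.add ((((Pg.const p).mul hJ2).mul (Pg.coord i)).mul_rd hg.2.1)).mul_pg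
      (sqmu_sm.2.1.pg.mul (hk.Nn_ps g i).2.1)
  have le1 : (∫ v, jap v ^ p * ∑ i, (hh g i v + p * (jap v ^ 2)⁻¹ * v i * g v) *
      (sqmu v * Nn ker g i v)) ≤ ∫ v, (K1 * (1 + p) ^ 2 * (jap v ^ m * Dd g v)
        + 3 / 2 * H * (jap v ^ p * P v * sqmu v)) := by
    refine integral_mono i0 ((iD.const_mul _).add (iP.const_mul _)) fun v => ?_
    dsimp only
    have hj := jap_pos v
    have hW := Real.rpow_pos_of_pos hj p
    have hs := sqmu_pos v
    set r := p * (jap v ^ 2)⁻¹ with hr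
    have hr0 : 0 ≤ r := by positivity
    have hr1 : r ≤ p := mul_le_of_le_one_right hp
      (inv_le_one_of_one_le₀ (by nlinarith [one_le_jap v]))
    have a1 : ∀ i, (hh g i v + r * v i * g v) ^ 2 ≤
        2 * (1 + p) ^ 2 * (pd i g v ^ 2 + v i ^ 2 * g v ^ 2) := fun i => by
      have b1 : (hh g i v + r * v i * g v) ^ 2 ≤
        2 * pd i g v ^ 2 + 2 * (1 / 2 + r) ^ 2 * (v i ^ 2 * g v ^ 2) := by
        unfold hh; nlinarith [sq_nonneg (pd i g v - (1 / 2 + r) * (v i * g v))]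
      have b2 : (1 / 2 + r) ^ 2 ≤ (1 + p) ^ 2 := by gcongr <;> linarith
      have b3 : 1 ≤ (1 + p) ^ 2 := by nlinarith
      have b4 := mul_le_mul_of_nonneg_right b2 (by positivity : 0 ≤ v i ^ 2 * g v ^ 2)
      have b5 := mul_le_mul_of_nonneg_right b3 (by positivity : 0 ≤ pd i g v ^ 2)
      linarith
    have a2 : ∀ i, (hh g i v + r * v i * g v) * (sqmu v * Nn ker g i v) ≤
        sqmu v * ((1 + p) ^ 2 * (pd i g v ^ 2 + v i ^ 2 * g v ^ 2)) + sqmu v * (1 / 2 * (P v * H)) :=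
      fun i => by
      have c1 := a1 i
      have c2 := hN g i v
      have : (hh g i v + r * v i * g v) * Nn ker g i v ≤
        (1 + p) ^ 2 * (pd i g v ^ 2 + v i ^ 2 * g v ^ 2) + 1 / 2 * (P v * H) := by
        nlinarith [sq_nonneg ((hh g i v + r * v i * g v) - Nn ker g i v)]
      have := mul_le_mul_of_nonneg_left this hs.le
      linarith
    have a3 := Finset.sum_le_sum fun i (_ : i ∈ Finset.univ) => a2 i
    have a4 : ∑ i, (hh g i v + r * v i * g v) * (sqmu v * Nn ker g i v) ≤
        sqmu v * (1 + p) ^ 2 * Dd g v + 3 / 2 * H * (P v * sqmu v) := by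
      refine a3.trans (le_of_eq ?_)
      unfold Dd; simp only [Fin.sum_univ_three]; ring
    have a5 := mul_le_mul_of_nonneg_left a4 hW.le
    have a6 := mul_le_mul_of_nonneg_right (hb1 v)
      (mul_nonneg (sq_nonneg (1 + p)) (Dd_nonneg g v))
    linarith
  rw [integral_add (iD.const_mul _) (iP.const_mul _), integral_const_mul, integral_const_mul,
    ← hK2] at le1
  have t1 := mul_le_mul_of_nonneg_left H1 (by positivity : 0 ≤ 3 / 2 * K2)
  have t2 := mul_le_mul_of_nonneg_left hDg
    (by positivity : 0 ≤ K1 * (1 + p) ^ 2 + 3 / 2 * K2 * (2 * K3))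
  linarith

theorem KH.coer (hk : KH ker n) {p : ℝ} (hp : 0 ≤ p) : ∃ C, 0 ≤ C ∧ ∀ g : SchwartzMap V3 ℝ,
    1 / 4 * (∫ v, jap v ^ p * Ee ker g v) - C * (∫ v, jap v ^ (p - 1) * Ee ker g v) ≤
      ∫ v, jap v ^ p * (Lg ker g v * g v) := by
  obtain ⟨C1, h1, hA⟩ := hk.Apart hp
  obtain ⟨C2, h2, hB⟩ := hk.Bpart hp
  refine ⟨C1 + C2, by positivity, fun g => ?_⟩
  have hg := schwartz_sm g
  have hJ2 : Pg (fun v => (jap v ^ 2)⁻¹) := by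
    have := jap_pg (-2)
    refine Pg.mono ?_ this fun v => ?_
    · unfold jap; fun_prop
    · rw [Real.rpow_neg (jap_pos v).le]; norm_num
  have r0 := fun i => (hh_sm g i).2.1.add ((((Pg.const p).mul hJ2).mul (Pg.coord i)).mul_rd hg.2.1)
  have iB := ((jap_pg p).mul_rd (Rd.sum Finset.univ fun i => (r0 i).mul_pg
      (sqmu_sm.2.1.pg.mul (hk.Nn_ps g i).2.1))).integrable
  have iA := ((jap_pg p).mul_rd (Rd.sum Finset.univ fun i => (r0 i).mul_pg
      (Pg.sum Finset.univ fun j => (hk.sg_ps i j).2.1.mul (hh_sm g j).2.1.pg))).integrable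
  have e : ∫ v, jap v ^ p * (Lg ker g v * g v) =
      (∫ v, jap v ^ p * ∑ i, (hh g i v + p * (jap v ^ 2)⁻¹ * v i * g v) * ∑ j, sg ker v i j * hh g j v)
      - ∫ v, jap v ^ p * ∑ i, (hh g i v + p * (jap v ^ 2)⁻¹ * v i * g v) * (sqmu v * Nn ker g i v) := by
    rw [hk.weak g p, ← integral_sub iA iB]
    congr 1; funext v
    unfold Xx
    rw [← mul_sub, ← Finset.sum_sub_distrib]
    simp_rw [mul_sub]
  have := hA g
  have := hB g
  rw [e]; linarith

end

theorem final_thm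
    (κ ϑ : ℝ) (hκ : κ ∈ Set.Icc (0 : ℝ) 1) (hϑ : ϑ < 0) :
    ∃ δ > (0 : ℝ), ∃ C > (0 : ℝ), ∀ g : SchwartzMap V3 ℝ,
      (∫ v : V3, jap v ^ (-(2 * ϑ)) * (Lkap κ ⇑g v * g v))
        ≥ δ ^ 2 * sKapNormSq κ ϑ ⇑g - C * sKapNormSq κ (ϑ + 1 / 2) ⇑g := by
  have hp : 0 ≤ -(2 * ϑ) := by linarith
  obtain ⟨C1, h1, hC⟩ := KH_C.coer hp
  obtain ⟨C2, h2, hR⟩ := KH_R.coer hp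
  refine ⟨1 / 2, by norm_num, C1 + C2 + 1, by positivity, fun g => ?_⟩
  have hg := schwartz_sm g
  have hc := hC g
  have hr := hR g
  have iC := ((jap_pg (-(2 * ϑ))).mul_rd ((KH_C.Lg_pg g).mul_rd hg.2.1)).integrable
  have iR := ((jap_pg (-(2 * ϑ))).mul_rd ((KH_R.Lg_pg g).mul_rd hg.2.1)).integrable
  have e : ∫ v : V3, jap v ^ (-(2 * ϑ)) * (Lkap κ ⇑g v * g v) =
      (∫ v, jap v ^ (-(2 * ϑ)) * (Lg kerC g v * g v))
      + κ * ∫ v, jap v ^ (-(2 * ϑ)) * (Lg kerR g v * g v) := by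
    rw [← integral_const_mul, ← integral_add iC (iR.const_mul _)]
    congr 1; funext v
    show jap v ^ (-(2 * ϑ)) * ((Lg kerC g v + κ * Lg kerR g v) * g v) = _
    ring
  have eC : ∀ ℓ, sNormSq ℓ g = ∫ v, jap v ^ (-(2 * ℓ)) * Ee kerC g v := fun ℓ => rfl
  have eR : ∀ ℓ, sRNormSq ℓ g = ∫ v, jap v ^ (2 * ℓ) * Ee kerR g v := fun ℓ => rfl
  have n1 : 0 ≤ ∫ v, jap v ^ (-(2 * ϑ) - 1) * Ee kerC g v := integral_nonneg fun v =>
    mul_nonneg (Real.rpow_pos_of_pos (jap_pos v) _).le (KH_C.Ee_nonneg g v)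
  have n2 : 0 ≤ ∫ v, jap v ^ (-(2 * ϑ) - 1) * Ee kerR g v := integral_nonneg fun v =>
    mul_nonneg (Real.rpow_pos_of_pos (jap_pos v) _).le (KH_R.Ee_nonneg g v)
  unfold sKapNormSq
  rw [e, eC, eC, eR, eR, show -(2 * (ϑ + 1 / 2)) = -(2 * ϑ) - 1 by ring,
    show 2 * -(ϑ + 1 / 2) = -(2 * ϑ) - 1 by ring, show 2 * -ϑ = -(2 * ϑ) by ring]
  have t1 := mul_le_mul_of_nonneg_left hr hκ.1
  have t2 : 0 ≤ (C2 + 1) * ∫ v, jap v ^ (-(2 * ϑ) - 1) * Ee kerC g v := by positivity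
  have t3 : 0 ≤ κ * ((C1 + 1) * ∫ v, jap v ^ (-(2 * ϑ) - 1) * Ee kerR g v) :=
    mul_nonneg hκ.1 (by positivity)
  show _ ≤ _
  linarith

/-- **Weighted coercivity of the regularized linearized Landau operator.** -/
theorem regularized_landau_weighted_coercivity
    (κ ϑ : ℝ) (hκ : κ ∈ Set.Icc (0 : ℝ) 1) (hϑ : ϑ < 0) :
    ∃ δ > (0 : ℝ), ∃ C > (0 : ℝ), ∀ g : SchwartzMap V3 ℝ,
      (∫ v : V3, jap v ^ (-(2 * ϑ)) * (Lkap κ ⇑g v * g v))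
        ≥ δ ^ 2 * sKapNormSq κ ϑ ⇑g - C * sKapNormSq κ (ϑ + 1 / 2) ⇑g :=
  final_thm κ ϑ hκ hϑ
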